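/- arXiv:1201.5842 — 8 statements merged into one kernel-verified Lean document; each statement's English description precedes it below -/
import Mathlib

section
/- Let s = −log₂ p where p is the unique root in (0,1) of p³ = (1−p)². For every θ ∈ (0,2), with gauge function ψ_θ(t) = t^s · exp(−|log t| / (log|log t|)^θ) for small t > 0 (extended to a continuous increasing function on [0,∞) with ψ_θ(0) = 0), one has H^{ψ_θ}(Ξ_G) = 0. -/
open MeasureTheory

noncomputable section

/-- The multiplicative golden mean shift: reals in `[0,1]` admitting a binary expansion
`x = ∑_{k≥1} x_k 2^{-k}` with digits in `{0,1}` satisfying `x_k * x_{2k} = 0` for all `k ≥ 1`. -/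
def XiG : Set ℝ :=
  {x | ∃ a : ℕ → ℕ, (∀ k, 1 ≤ k → a k = 0 ∨ a k = 1) ∧
    (∀ k, 1 ≤ k → a k * a (2 * k) = 0) ∧
    x = ∑' k : ℕ, (a (k + 1) : ℝ) / 2 ^ (k + 1)}

/-- A gauge function: continuous and increasing on `[0,∞)` with `φ(0) = 0`. -/
def IsGauge (φ : ℝ → ℝ) : Prop :=
  φ 0 = 0 ∧ ContinuousOn φ (Set.Ici 0) ∧ StrictMonoOn φ (Set.Ici 0)

/-- The generalized Hausdorff measure with gauge `φ`. -/
def gaugeMeasure {X : Type*} [EMetricSpace X] [MeasurableSpace X] [BorelSpace X]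
    (φ : ℝ → ℝ) : Measure X :=
  Measure.mkMetric fun d => ENNReal.ofReal (φ d.toReal)

open Finset in
theorem bounded_not_harmonic_growth (f : ℕ → ℝ) (b C : ℝ) (hb : 0 < b) (hC : ∀ k, f k ≤ C)
    (K : ℕ)
    (h : ∀ k, K ≤ k → |f (k + 1)| / (k + 1) + b / (k + 1) ^ 2 ≤ f (k + 1) - f k) : False := by
  have harm : ∀ (g : ℕ → ℝ) (c : ℝ) (L : ℕ), 0 < c →
      (∀ k, L ≤ k → c * (1 / ((k : ℝ) + 1)) ≤ g (k + 1) - g k) → ∀ R : ℝ, ∃ k, L ≤ k ∧ R < g k := by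
    intro g c L hc hg R
    have hsum : ∀ k, L ≤ k → g L + c * (∑ i ∈ range k, 1 / ((i : ℝ) + 1) -
        ∑ i ∈ range L, 1 / ((i : ℝ) + 1)) ≤ g k := by
      intro k hk
      induction k, hk using Nat.le_induction with
      | base => simp
      | succ k hk ih =>
        rw [sum_range_succ]
        linarith [hg k hk]
    have ht := Real.tendsto_sum_range_one_div_nat_succ_atTop
    obtain ⟨k, hk, hLk⟩ := ((ht.eventually_gt_atTop ((R - g L) / c +
      ∑ i ∈ range L, 1 / ((i : ℝ) + 1))).and (Filter.eventually_ge_atTop L)).exists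
    refine ⟨k, hLk, lt_of_lt_of_le ?_ (hsum k hLk)⟩
    have : (R - g L) / c < ∑ i ∈ range k, 1 / ((i : ℝ) + 1) -
        ∑ i ∈ range L, 1 / ((i : ℝ) + 1) := by linarith
    rw [div_lt_iff₀ hc] at this
    linarith
  obtain ⟨L, hKL, hL⟩ := harm (fun k => ((k : ℝ) + 1) * f k) b K hb (by
    intro k hk
    have h1 := h k hk
    have h2 : 0 < (k : ℝ) + 1 := by positivity
    have h3 : (|f (k + 1)| / (k + 1) + b / (k + 1) ^ 2) * (k + 1) =
      |f (k + 1)| + b * (1 / ((k : ℝ) + 1)) := by field_simp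
    have h4 := mul_le_mul_of_nonneg_right h1 h2.le
    rw [h3] at h4
    push_cast
    nlinarith [neg_abs_le (f (k + 1))]) 0
  have hfL : 0 < f L := by
    have : 0 < (L : ℝ) + 1 := by positivity
    exact (pos_iff_pos_of_mul_pos hL).1 this
  have hmono : ∀ k, L ≤ k → f L ≤ f k := by
    intro k hk
    induction k, hk using Nat.le_induction with
    | base => exact le_rfl
    | succ k hk ih =>
      have : 0 ≤ |f (k + 1)| / ((k : ℝ) + 1) + b / ((k : ℝ) + 1) ^ 2 := by positivity
      linarith [h k (hKL.trans hk)]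
  obtain ⟨k, -, hk⟩ := harm f (f L) L hfL (by
    intro k hk
    have h1 : 0 ≤ b / ((k : ℝ) + 1) ^ 2 := by positivity
    have h2 : f L * (1 / ((k : ℝ) + 1)) ≤ |f (k + 1)| / (k + 1) := by
      rw [mul_one_div]
      gcongr
      exact (hmono (k + 1) (by omega)).trans (le_abs_self _)
    linarith [h k (hKL.trans hk)]) C
  exact absurd (hC k) (not_le.2 hk)

/-- The conditional probability of the digit of `A` at position `j` given the digit at `j / 2`. -/
def transitionWeight (q : ℝ) (A : Set ℕ) (j : ℕ) : ℝ :=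
  open Classical in
  if Even j ∧ j / 2 ∈ A then (if j ∈ A then 0 else 1) else (if j ∈ A then 1 - q else q)

/-- The mass of the cylinder of length `n` coded by `A`. -/
def cylinderWeight (q : ℝ) (A : Set ℕ) (n : ℕ) : ℝ :=
  ∏ j ∈ Finset.Icc 1 n, transitionWeight q A j

theorem transitionWeight_nonneg {q : ℝ} (hq : q ∈ Set.Ioo (0 : ℝ) 1) (A : Set ℕ) (j : ℕ) :
    0 ≤ transitionWeight q A j := by
  have := hq.1
  have := hq.2
  unfold transitionWeight
  split_ifs <;> linarith

theorem cylinderWeight_nonneg {q : ℝ} (hq : q ∈ Set.Ioo (0 : ℝ) 1) (A : Set ℕ) (n : ℕ) :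
    0 ≤ cylinderWeight q A n :=
  Finset.prod_nonneg fun j _ => transitionWeight_nonneg hq A j

theorem transitionWeight_congr {q : ℝ} {A B : Set ℕ} {n j : ℕ}
    (h : ∀ i, 1 ≤ i → i ≤ n → (i ∈ A ↔ i ∈ B)) (h1 : 1 ≤ j) (hj : j ≤ n) :
    transitionWeight q A j = transitionWeight q B j := by
  unfold transitionWeight
  have e1 : (Even j ∧ j / 2 ∈ A) ↔ (Even j ∧ j / 2 ∈ B) := by
    refine and_congr_right fun he => h _ ?_ ?_
    · obtain ⟨r, rfl⟩ := he; omega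
    · omega
  have e2 := h j h1 hj
  by_cases ha : Even j ∧ j / 2 ∈ A <;> by_cases hb : j ∈ A
  all_goals
    have ha' := ha
    have hb' := hb
    rw [e1] at ha'
    rw [e2] at hb'
    simp only [ha, ha', hb, hb', if_true, if_false]

theorem cylinderWeight_congr {q : ℝ} {A B : Set ℕ} {n : ℕ}
    (h : ∀ i, 1 ≤ i → i ≤ n → (i ∈ A ↔ i ∈ B)) :
    cylinderWeight q A n = cylinderWeight q B n :=
  Finset.prod_congr rfl fun _ hj =>
    transitionWeight_congr h (Finset.mem_Icc.1 hj).1 (Finset.mem_Icc.1 hj).2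

theorem cylinderWeight_succ (q : ℝ) (A : Set ℕ) (n : ℕ) :
    cylinderWeight q A (n + 1) = cylinderWeight q A n * transitionWeight q A (n + 1) :=
  Finset.prod_Icc_succ_top (by omega) _

theorem sum_cylinderWeight (q : ℝ) (n : ℕ) :
    ∑ A ∈ (Finset.Icc 1 n).powerset, cylinderWeight q (A : Set ℕ) n = 1 := by
  induction n with
  | zero => simp [cylinderWeight]
  | succ n ih =>
    have hI : Finset.Icc 1 (n + 1) = insert (n + 1) (Finset.Icc 1 n) := by
      ext j; simp only [Finset.mem_Icc, Finset.mem_insert]; omega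
    rw [hI, Finset.sum_powerset_insert (by simp), ← Finset.sum_add_distrib, ← ih]
    refine Finset.sum_congr rfl fun A hA => ?_
    have hA' : n + 1 ∉ A := fun hn => by
      have := Finset.mem_Icc.1 (Finset.mem_powerset.1 hA hn); omega
    have hc : cylinderWeight q ((insert (n + 1) A : Finset ℕ) : Set ℕ) n =
        cylinderWeight q (A : Set ℕ) n := by
      refine cylinderWeight_congr fun i _ hi => ?_
      simp only [Finset.mem_coe, Finset.mem_insert]
      exact ⟨fun h => h.resolve_left (by omega), Or.inr⟩
    rw [cylinderWeight_succ, cylinderWeight_succ, hc, ← mul_add]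
    have : transitionWeight q (A : Set ℕ) (n + 1) +
        transitionWeight q ((insert (n + 1) A : Finset ℕ) : Set ℕ) (n + 1) = 1 := by
      have hh : (n + 1) / 2 ≠ n + 1 := by omega
      unfold transitionWeight
      simp only [Finset.mem_coe, Finset.mem_insert, hh, false_or, true_or, hA', if_true, if_false]
      split_ifs <;> ring
    rw [this, mul_one]

/-- The number of elements of `A` in `{1, …, n}`. -/
def countUpTo (A : Set ℕ) (n : ℕ) : ℝ :=
  open Classical in ∑ j ∈ Finset.Icc 1 n, if j ∈ A then 1 else 0

open Classical in
theorem countUpTo_succ (A : Set ℕ) (n : ℕ) :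
    countUpTo A (n + 1) = countUpTo A n + if n + 1 ∈ A then 1 else 0 :=
  Finset.sum_Icc_succ_top (by omega) _

theorem countUpTo_nonneg (A : Set ℕ) (n : ℕ) : 0 ≤ countUpTo A n := by
  unfold countUpTo; positivity

theorem countUpTo_le (A : Set ℕ) (n : ℕ) : countUpTo A n ≤ n := by
  classical
  induction n with
  | zero => simp [countUpTo]
  | succ n ih => rw [countUpTo_succ]; push_cast; split_ifs <;> linarith

theorem cylinderWeight_eq_exp {q : ℝ} (hq : q ∈ Set.Ioo (0 : ℝ) 1) {A : Set ℕ}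
    (hA : ∀ k, 1 ≤ k → k ∈ A → 2 * k ∉ A) (n : ℕ) :
    cylinderWeight q A n = Real.exp (countUpTo A n * Real.log (1 - q) +
      (n - countUpTo A n - countUpTo A (n / 2)) * Real.log q) := by
  classical
  have h0 := Real.exp_log hq.1
  have h1 := Real.exp_log (sub_pos.2 hq.2)
  induction n with
  | zero => simp [cylinderWeight, countUpTo]
  | succ n ih =>
    rw [cylinderWeight_succ, ih, countUpTo_succ]
    unfold transitionWeight
    have hhalf : countUpTo A ((n + 1) / 2) = countUpTo A (n / 2) +
        if Even (n + 1) ∧ (n + 1) / 2 ∈ A then 1 else 0 := by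
      rcases Nat.even_or_odd' (n + 1) with ⟨r, hr | hr⟩
      · obtain ⟨m, rfl⟩ : ∃ m, r = m + 1 := ⟨r - 1, by omega⟩
        have e1 : (n + 1) / 2 = m + 1 := by omega
        have e2 : n / 2 = m := by omega
        have e3 : Even (n + 1) := ⟨m + 1, by omega⟩
        rw [e1, e2, countUpTo_succ]
        simp only [e3, true_and]
      · have e1 : (n + 1) / 2 = n / 2 := by omega
        have e3 : ¬ Even (n + 1) := by rw [Nat.even_iff]; omega
        rw [e1]; simp [e3]
    rw [hhalf]
    by_cases hE : Even (n + 1) ∧ (n + 1) / 2 ∈ A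
    · have hn : n + 1 ∉ A := by
        obtain ⟨⟨r, hr⟩, hm⟩ := hE
        have e : (n + 1) / 2 = r := by omega
        rw [e] at hm
        have := hA r (by omega) hm
        rwa [show n + 1 = 2 * r by omega]
      simp only [hE, hn, and_self, if_true, if_false]
      rw [mul_one]; push_cast; congr 1; ring
    · by_cases hn : n + 1 ∈ A
      · simp only [hE, hn, if_true, if_false]
        nth_rw 2 [← h1]
        rw [← Real.exp_add]; push_cast; congr 1; ring
      · simp only [hE, hn, if_false]
        nth_rw 3 [← h0]
        rw [← Real.exp_add]; push_cast; congr 1; ring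

/-- The asymptotic frequency of the digit `1` for the optimal Markov weights. -/
def digitDensity (p : ℝ) : ℝ := 2 * (1 - p) / (3 - p)

/-- The exponential rate at which the weights with parameter `q` respond to the frequency of the
digit `1`. -/
def tiltRate (q : ℝ) : ℝ := Real.log (1 - q) - 3 / 2 * Real.log q

theorem tiltRate_eq_zero {p : ℝ} (hpe : p ^ 3 = (1 - p) ^ 2) :
    tiltRate p = 0 := by
  have h := congrArg Real.log hpe
  rw [Real.log_pow, Real.log_pow] at h
  unfold tiltRate
  push_cast at h
  linarith

theorem log_sub_log_ge {a b : ℝ} (ha : 0 < a) (hb : 0 < b) :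
    1 - b / a ≤ Real.log a - Real.log b := by
  have h := Real.one_sub_inv_le_log_of_pos (div_pos ha hb)
  rwa [inv_div, Real.log_div ha.ne' hb.ne'] at h

theorem abs_sub_le_abs_tiltRate {p q : ℝ} (hp : p ∈ Set.Ioo (0 : ℝ) 1)
    (hpe : p ^ 3 = (1 - p) ^ 2) (hq : q ∈ Set.Ioo (0 : ℝ) 1) :
    (q ≤ p → p - q ≤ tiltRate q) ∧ (p ≤ q → tiltRate q ≤ -(q - p)) := by
  have h0 := tiltRate_eq_zero hpe
  unfold tiltRate at *
  obtain ⟨hp0, hp1⟩ := hp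
  obtain ⟨hq0, hq1⟩ := hq
  constructor
  · intro hqp
    have h1 := log_sub_log_ge hp0 hq0
    have h2 : Real.log (1 - p) ≤ Real.log (1 - q) := Real.log_le_log (by linarith) (by linarith)
    have h3 : p - q ≤ 1 - q / p := by
      rw [one_sub_div hp0.ne', le_div_iff₀ hp0]
      nlinarith
    linarith
  · intro hqp
    have h1 := log_sub_log_ge (sub_pos.2 hp1) (sub_pos.2 hq1)
    have h2 : Real.log p ≤ Real.log q := Real.log_le_log hp0 hqp
    have h3 : q - p ≤ 1 - (1 - q) / (1 - p) := by
      rw [one_sub_div (sub_pos.2 hp1).ne', le_div_iff₀ (sub_pos.2 hp1)]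
      nlinarith
    linarith

theorem log_sub_log_add_density_mul_tiltRate_ge {p q : ℝ} (hp : p ∈ Set.Ioo (0 : ℝ) 1)
    (hpe : p ^ 3 = (1 - p) ^ 2) (hq0 : p / 2 ≤ q) (hq1 : (1 - p) / 2 ≤ 1 - q) :
    -(4 / (p * (1 - p)) * (q - p) ^ 2) ≤
      Real.log q - Real.log p + digitDensity p * tiltRate q := by
  have h0 := tiltRate_eq_zero hpe
  obtain ⟨hp0, hp1⟩ := hp
  have hp1' : 0 < 1 - p := by linarith
  have hqp : 0 < q := by linarith
  have hqp' : 0 < 1 - q := by linarith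
  have h3 : 0 < 3 - p := by linarith
  have hlog := log_sub_log_ge hqp hp0
  have hlog' := log_sub_log_ge hqp' hp1'
  have hid : Real.log q - Real.log p + digitDensity p * tiltRate q =
      2 / (3 - p) * (p * (Real.log q - Real.log p) +
        (1 - p) * (Real.log (1 - q) - Real.log (1 - p))) := by
    have : Real.log (1 - p) = 3 / 2 * Real.log p := by unfold tiltRate at h0; linarith
    rw [this]
    unfold digitDensity tiltRate
    field_simp
    ring
  have hchi : -((q - p) ^ 2 / (q * (1 - q))) ≤ p * (Real.log q - Real.log p) +
        (1 - p) * (Real.log (1 - q) - Real.log (1 - p)) := by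
    have e : -((q - p) ^ 2 / (q * (1 - q))) =
        p * (1 - p / q) + (1 - p) * (1 - (1 - p) / (1 - q)) := by
      field_simp
      ring
    rw [e]
    gcongr
  have hden : (q - p) ^ 2 / (q * (1 - q)) ≤ 4 / (p * (1 - p)) * (q - p) ^ 2 := by
    rw [div_mul_eq_mul_div, div_le_div_iff₀ (by positivity) (by positivity)]
    have : p * (1 - p) ≤ 4 * (q * (1 - q)) := by nlinarith
    nlinarith [mul_le_mul_of_nonneg_left this (sq_nonneg (q - p))]
  have hfac : 2 / (3 - p) ≤ 1 := by rw [div_le_one h3]; linarith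
  have hfac0 : 0 < 2 / (3 - p) := by positivity
  have hX : 0 ≤ (q - p) ^ 2 / (q * (1 - q)) := by positivity
  rw [hid]
  nlinarith [mul_le_mul_of_nonneg_left hchi hfac0.le, mul_le_mul_of_nonneg_right hfac hX]

theorem log_cylinderWeight_two_pow {q : ℝ} (hq : q ∈ Set.Ioo (0 : ℝ) 1) {A : Set ℕ}
    (hA : ∀ k, 1 ≤ k → k ∈ A → 2 * k ∉ A) (k : ℕ) :
    cylinderWeight q A (2 ^ (k + 1)) = Real.exp (2 ^ (k + 1) *
      (Real.log q + countUpTo A (2 ^ (k + 1)) / 2 ^ (k + 1) * tiltRate q +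
        1 / 2 * (countUpTo A (2 ^ (k + 1)) / 2 ^ (k + 1) - countUpTo A (2 ^ k) / 2 ^ k) *
          Real.log q)) := by
  rw [cylinderWeight_eq_exp hq hA]
  have : 2 ^ (k + 1) / 2 = 2 ^ k := by rw [pow_succ]; omega
  rw [this]
  congr 1
  unfold tiltRate
  push_cast
  field_simp
  ring

theorem exists_cylinderWeight_ge {p : ℝ} (hp : p ∈ Set.Ioo (0 : ℝ) 1)
    (hpe : p ^ 3 = (1 - p) ^ 2) :
    ∃ M Λ : ℝ, ∀ᶠ N : ℕ in Filter.atTop,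
      (∀ k : ℕ, N ≤ k → p + M / (k + 1) ∈ Set.Ioo (0 : ℝ) 1 ∧
        p - M / (k + 1) ∈ Set.Ioo (0 : ℝ) 1) ∧
      ∀ A : Set ℕ, (∀ k, 1 ≤ k → k ∈ A → 2 * k ∉ A) → ∃ k : ℕ, N ≤ k ∧
        ∃ q, (q = p + M / (k + 1) ∨ q = p - M / (k + 1)) ∧
          p ^ 2 ^ (k + 1) * Real.exp (-(2 ^ (k + 1) * (Λ / (k + 1) ^ 2))) ≤
            cylinderWeight q A (2 ^ (k + 1)) := by
  have hp0 := hp.1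
  have hp1 := hp.2
  set M : ℝ := Real.log 2 - Real.log (p / 2) with hM
  have hMpos : 0 < M := by
    have : Real.log (p / 2) < Real.log 2 := Real.log_lt_log (by linarith) (by linarith)
    linarith
  set C : ℝ := 4 / (p * (1 - p)) with hC
  refine ⟨M, C * M ^ 2 + 1, ?_⟩
  have hsmall : ∀ᶠ N : ℕ in Filter.atTop, M / ((N : ℝ) + 1) < min (p / 2) ((1 - p) / 2) := by
    have : Filter.Tendsto (fun N : ℕ => M / ((N : ℝ) + 1)) Filter.atTop (nhds 0) :=
      Filter.Tendsto.div_atTop tendsto_const_nhds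
        (Filter.tendsto_atTop_add_const_right _ _ tendsto_natCast_atTop_atTop)
    exact this.eventually_lt_const (lt_min (by linarith) (by linarith))
  filter_upwards [hsmall] with N hN
  have hε : ∀ k : ℕ, N ≤ k → 0 < M / ((k : ℝ) + 1) ∧ M / ((k : ℝ) + 1) < p / 2 ∧
      M / ((k : ℝ) + 1) < (1 - p) / 2 := by
    intro k hk
    have hle : M / ((k : ℝ) + 1) ≤ M / ((N : ℝ) + 1) := by gcongr
    have := lt_min_iff.1 (hle.trans_lt hN)
    exact ⟨by positivity, this⟩
  have hmem : ∀ k : ℕ, N ≤ k → p + M / (k + 1) ∈ Set.Ioo (0 : ℝ) 1 ∧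
        p - M / (k + 1) ∈ Set.Ioo (0 : ℝ) 1 := by
    intro k hk
    obtain ⟨h1, h2, h3⟩ := hε k hk
    exact ⟨⟨by linarith, by linarith⟩, ⟨by linarith, by linarith⟩⟩
  refine ⟨hmem, fun A hA => ?_⟩
  by_contra! hcon
  set f : ℕ → ℝ := fun k => countUpTo A (2 ^ k) / 2 ^ k - digitDensity p with hf
  refine bounded_not_harmonic_growth f (1 / M) (1 - digitDensity p) (by positivity) ?_ N ?_
  · intro k
    have h := countUpTo_le A (2 ^ k)
    have : countUpTo A (2 ^ k) / 2 ^ k ≤ 1 := by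
      rw [div_le_one (by positivity)]; exact_mod_cast h
    simp only [hf]; linarith
  · intro k hk
    obtain ⟨h1, h2, h3⟩ := hε k hk
    set ε := M / ((k : ℝ) + 1) with hεdef
    obtain ⟨q, hq, hqabs, hqf⟩ : ∃ q, (q = p + ε ∨ q = p - ε) ∧ (q - p) ^ 2 = ε ^ 2 ∧
        ε * |f (k + 1)| ≤ f (k + 1) * tiltRate q := by
      rcases le_total 0 (f (k + 1)) with hs | hs
      · refine ⟨p - ε, Or.inr rfl, by ring, ?_⟩
        have := (abs_sub_le_abs_tiltRate hp hpe (hmem k hk).2).1 (by linarith)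
        rw [abs_of_nonneg hs, mul_comm]
        exact mul_le_mul_of_nonneg_left (by linarith) hs
      · refine ⟨p + ε, Or.inl rfl, by ring, ?_⟩
        have := (abs_sub_le_abs_tiltRate hp hpe (hmem k hk).1).2 (by linarith)
        rw [abs_of_nonpos hs]
        nlinarith
    have hq01 : q ∈ Set.Ioo (0 : ℝ) 1 := by
      rcases hq with rfl | rfl
      exacts [(hmem k hk).1, (hmem k hk).2]
    have hql : p / 2 ≤ q := by rcases hq with rfl | rfl <;> linarith
    have hqu : (1 - p) / 2 ≤ 1 - q := by rcases hq with rfl | rfl <;> linarith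
    have hlt := hcon k hk q hq
    have hpexp : p ^ 2 ^ (k + 1) = Real.exp (2 ^ (k + 1) * Real.log p) := by
      rw [← Real.exp_log (pow_pos hp0 _), Real.log_pow]; push_cast; rfl
    rw [log_cylinderWeight_two_pow hq01 hA, hpexp, ← Real.exp_add, Real.exp_lt_exp,
      ← sub_eq_add_neg, ← mul_sub] at hlt
    have hlt' := lt_of_mul_lt_mul_left hlt (by positivity)
    have hD := log_sub_log_add_density_mul_tiltRate_ge hp hpe hql hqu
    rw [hqabs] at hD
    have hstep : countUpTo A (2 ^ (k + 1)) / 2 ^ (k + 1) - countUpTo A (2 ^ k) / 2 ^ k =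
        f (k + 1) - f k := by simp only [hf]; ring
    have hlev : countUpTo A (2 ^ (k + 1)) / 2 ^ (k + 1) = f (k + 1) + digitDensity p := by
      simp only [hf]; ring
    rw [hstep, hlev] at hlt'
    have hCε : (C * M ^ 2 + 1) / ((k : ℝ) + 1) ^ 2 = C * ε ^ 2 + 1 / ((k : ℝ) + 1) ^ 2 := by
      rw [hεdef]; field_simp
    rw [hCε] at hlt'
    have hmain : ε * |f (k + 1)| + 1 / ((k : ℝ) + 1) ^ 2 ≤
        1 / 2 * (f (k + 1) - f k) * (-Real.log q) := by
      linarith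
    have hlogq : -Real.log q ≤ M := by
      have := Real.log_le_log (by linarith) hql
      have := Real.log_nonneg (x := 2) (by norm_num)
      linarith
    have hlogq0 : 0 < -Real.log q := neg_pos.2 (Real.log_neg hq01.1 hq01.2)
    have hpos : 0 < ε * |f (k + 1)| + 1 / ((k : ℝ) + 1) ^ 2 := by positivity
    have hΔ : 0 < f (k + 1) - f k := by
      have := (pos_iff_pos_of_mul_pos (hpos.trans_le hmain)).2 hlogq0
      linarith
    have hfin : ε * |f (k + 1)| + 1 / ((k : ℝ) + 1) ^ 2 ≤ M * (f (k + 1) - f k) := by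
      nlinarith
    have hrew : |f (k + 1)| / ((k : ℝ) + 1) + 1 / M / ((k : ℝ) + 1) ^ 2 =
        (ε * |f (k + 1)| + 1 / ((k : ℝ) + 1) ^ 2) / M := by
      rw [hεdef]; field_simp
    rw [hrew, div_le_iff₀ hMpos]
    linarith

theorem mem_Icc_of_binary_expansion {a : ℕ → ℕ} (ha : ∀ k, 1 ≤ k → a k = 0 ∨ a k = 1) (n : ℕ) :
    ∑' k : ℕ, (a (k + 1) : ℝ) / 2 ^ (k + 1) ∈
      Set.Icc (∑ j ∈ Finset.Icc 1 n with a j = 1, ((2 : ℝ) ^ j)⁻¹)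
        (∑ j ∈ Finset.Icc 1 n with a j = 1, ((2 : ℝ) ^ j)⁻¹ + (1 / 2) ^ n) := by
  have hgeo : HasSum (fun k : ℕ => (1 / 2 : ℝ) ^ (k + 1)) 1 := by
    have := hasSum_geometric_two.mul_left (1 / 2 : ℝ)
    simpa [pow_succ'] using this
  have hle : ∀ k, (a (k + 1) : ℝ) / 2 ^ (k + 1) ≤ (1 / 2) ^ (k + 1) := by
    intro k
    rw [one_div_pow]
    gcongr
    rcases ha (k + 1) (by omega) with h | h <;> simp [h]
  have hs : Summable (fun k : ℕ => (a (k + 1) : ℝ) / 2 ^ (k + 1)) :=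
    Summable.of_nonneg_of_le (fun k => by positivity) hle hgeo.summable
  have hhead : ∑ k ∈ Finset.range n, (a (k + 1) : ℝ) / 2 ^ (k + 1) =
      ∑ j ∈ Finset.Icc 1 n with a j = 1, ((2 : ℝ) ^ j)⁻¹ := by
    rw [Finset.sum_filter]
    clear hs hle hgeo
    induction n with
    | zero => simp
    | succ n ih =>
      rw [Finset.sum_range_succ, ih, Finset.sum_Icc_succ_top (by omega)]
      rcases ha (n + 1) (by omega) with h | h <;> simp [h]
  rw [← hs.sum_add_tsum_nat_add n, hhead]
  have htail : ∑' k : ℕ, (a (k + n + 1) : ℝ) / 2 ^ (k + n + 1) ≤ (1 / 2) ^ n := by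
    have h2 : HasSum (fun k : ℕ => (1 / 2 : ℝ) ^ (k + n + 1)) ((1 / 2) ^ n) := by
      have := hgeo.mul_left ((1 / 2 : ℝ) ^ n)
      rw [mul_one] at this
      refine this.congr_fun ?_
      intro k; ring
    rw [← h2.tsum_eq]
    exact ((summable_nat_add_iff n).2 hs).tsum_le_tsum (fun k => hle (k + n)) h2.summable
  have htail0 : 0 ≤ ∑' k : ℕ, (a (k + n + 1) : ℝ) / 2 ^ (k + n + 1) :=
    tsum_nonneg fun k => by positivity
  constructor <;> linarith

theorem gauge_dyadic_le {p θ : ℝ} (hp : p ∈ Set.Ioo (0 : ℝ) 1) (hθ : θ ∈ Set.Ioo (0 : ℝ) 2)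
    {ψ : ℝ → ℝ}
    (hψ : ∃ t₀ > (0 : ℝ), ∀ t ∈ Set.Ioo (0 : ℝ) t₀,
        ψ t = t ^ (-Real.logb 2 p) *
          Real.exp (-|Real.log t| / (Real.log |Real.log t|) ^ θ)) (Λ : ℝ) :
    ∀ᶠ k : ℕ in Filter.atTop, ψ ((1 / 2) ^ 2 ^ k) ≤
      p ^ 2 ^ k * Real.exp (-(2 ^ k * (Λ / k ^ 2))) * Real.exp (-k) := by
  obtain ⟨t₀, ht₀, hψ⟩ := hψ
  have hlim : Filter.Tendsto (fun k : ℕ => (1 / 2 : ℝ) ^ 2 ^ k) Filter.atTop (nhds 0) :=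
    (tendsto_pow_atTop_nhds_zero_of_lt_one (by norm_num) (by norm_num)).comp
      (tendsto_pow_atTop_atTop_of_one_lt (by norm_num : 1 < 2))
  have hpow : ∀ᶠ k : ℕ in Filter.atTop, (k : ℝ) ^ 3 / 2 ^ k < 1 :=
    (tendsto_pow_const_div_const_pow_of_one_lt 3 (by norm_num : (1 : ℝ) < 2)).eventually_lt_const
      (by norm_num)
  have hgain : ∀ᶠ k : ℕ in Filter.atTop, (Λ + 1) / Real.log 2 ≤ (k : ℝ) ^ (2 - θ) :=
    ((tendsto_rpow_atTop (by linarith [hθ.2])).comp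
      tendsto_natCast_atTop_atTop).eventually_ge_atTop _
  filter_upwards [hlim.eventually_lt_const ht₀, hpow, hgain, Filter.eventually_ge_atTop 2]
    with k h1 h2 h3 hk
  have hkpos : (0 : ℝ) < k := by exact_mod_cast (by omega : 0 < k)
  have hl2 : 0 < Real.log 2 := Real.log_pos (by norm_num)
  rw [hψ _ ⟨by positivity, h1⟩]
  have hlog : Real.log ((1 / 2 : ℝ) ^ 2 ^ k) = -(2 ^ k * Real.log 2) := by
    rw [Real.log_pow, one_div, Real.log_inv]; push_cast; ring
  rw [hlog, abs_neg, abs_of_nonneg (by positivity)]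
  have hmain : ((1 / 2 : ℝ) ^ 2 ^ k) ^ (-Real.logb 2 p) = p ^ 2 ^ k := by
    rw [Real.rpow_def_of_pos (by positivity), hlog, ← Real.exp_log (pow_pos hp.1 _),
      Real.log_pow, Real.logb]
    push_cast
    congr 1
    field_simp
  rw [hmain, mul_assoc, ← Real.exp_add]
  refine mul_le_mul_of_nonneg_left (Real.exp_le_exp.2 ?_) (pow_nonneg hp.1.le _)
  have hlow : 1 < (2 : ℝ) ^ k * Real.log 2 := by
    have h4 : (2 : ℝ) ^ 2 ≤ 2 ^ k := pow_le_pow_right₀ (by norm_num) hk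
    nlinarith [Real.log_two_gt_d9]
  have hll : 0 < Real.log ((2 : ℝ) ^ k * Real.log 2) := Real.log_pos hlow
  have hlu : Real.log ((2 : ℝ) ^ k * Real.log 2) ≤ k := by
    rw [Real.log_mul (by positivity) hl2.ne', Real.log_pow]
    have := Real.log_nonpos hl2.le (Real.log_two_lt_d9.le.trans (by norm_num))
    nlinarith [Real.log_two_lt_d9]
  have hpw : Real.log ((2 : ℝ) ^ k * Real.log 2) ^ θ ≤ (k : ℝ) ^ θ :=
    Real.rpow_le_rpow hll.le hlu hθ.1.le
  have hdiv : (2 : ℝ) ^ k * Real.log 2 / (k : ℝ) ^ θ ≤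
      2 ^ k * Real.log 2 / Real.log ((2 : ℝ) ^ k * Real.log 2) ^ θ :=
    div_le_div_of_nonneg_left (by positivity) (Real.rpow_pos_of_pos hll _) hpw
  have hsq : (k : ℝ) ^ θ * (k : ℝ) ^ (2 - θ) = (k : ℝ) ^ 2 := by
    rw [← Real.rpow_add hkpos, ← Real.rpow_natCast]; congr 1; push_cast; ring
  have hgain' : (2 : ℝ) ^ k * ((Λ + 1) / k ^ 2) ≤ 2 ^ k * Real.log 2 / (k : ℝ) ^ θ := by
    rw [mul_div_assoc]
    refine mul_le_mul_of_nonneg_left ?_ (by positivity)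
    rw [div_le_div_iff₀ (by positivity) (by positivity), ← hsq]
    rw [div_le_iff₀ hl2] at h3
    have : 0 < (k : ℝ) ^ θ := by positivity
    nlinarith [mul_le_mul_of_nonneg_left h3 this.le]
  have hk3 : (k : ℝ) ≤ 2 ^ k * (1 / k ^ 2) := by
    rw [div_lt_one (by positivity)] at h2
    rw [mul_one_div, le_div_iff₀ (by positivity)]
    nlinarith
  rw [neg_div]
  have : (2 : ℝ) ^ k * ((Λ + 1) / k ^ 2) = 2 ^ k * (Λ / k ^ 2) + 2 ^ k * (1 / k ^ 2) := by ring
  linarith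

/-- For every `θ ∈ (0,2)` and every gauge function `ψ` agreeing with
`t ↦ t^s · exp(-|log t|/(log|log t|)^θ)` near `0` (where `s = -log₂ p`), the generalized
Hausdorff measure `H^ψ` of `Ξ_G` vanishes. -/
theorem gaugeMeasure_XiG_zero (p : ℝ) (hp : p ∈ Set.Ioo (0 : ℝ) 1)
    (hpe : p ^ 3 = (1 - p) ^ 2) (θ : ℝ) (hθ : θ ∈ Set.Ioo (0 : ℝ) 2) :
    ∀ ψ : ℝ → ℝ, IsGauge ψ →
      (∃ t₀ > (0 : ℝ), ∀ t ∈ Set.Ioo (0 : ℝ) t₀,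
        ψ t = t ^ (-Real.logb 2 p) *
          Real.exp (-|Real.log t| / (Real.log |Real.log t|) ^ θ)) →
      gaugeMeasure ψ XiG = 0 := by
  classical
  intro ψ _ hψ
  obtain ⟨M, Λ, hgood⟩ := exists_cylinderWeight_ge hp hpe
  have hdecay := (Filter.tendsto_add_atTop_nat 1).eventually (gauge_dyadic_le hp hθ hψ Λ)
  obtain ⟨K, hK⟩ := Filter.eventually_atTop.1 (hgood.and hdecay)
  set good : ℕ → Finset (Finset ℕ) := fun k =>
    {A ∈ (Finset.Icc 1 (2 ^ (k + 1))).powerset | ∃ q, (q = p + M / (k + 1) ∨ q = p - M / (k + 1)) ∧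
          p ^ 2 ^ (k + 1) * Real.exp (-(2 ^ (k + 1) * (Λ / (k + 1) ^ 2))) ≤
            cylinderWeight q (A : Set ℕ) (2 ^ (k + 1))}
  have hsum : ∀ k, K ≤ k → ∑ _A ∈ good k, ENNReal.ofReal (ψ ((1 / 2) ^ 2 ^ (k + 1))) ≤
      ENNReal.ofReal (2 * Real.exp (-(k : ℝ))) := by
    intro k hk
    obtain ⟨⟨hmem, -⟩, hdec⟩ := hK k hk
    obtain ⟨hm1, hm2⟩ := hmem k le_rfl
    set w : Finset ℕ → ℝ := fun A => cylinderWeight (p + M / (k + 1)) (A : Set ℕ) (2 ^ (k + 1)) +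
      cylinderWeight (p - M / (k + 1)) (A : Set ℕ) (2 ^ (k + 1)) with hw
    have hw0 : ∀ A, 0 ≤ w A := fun A =>
      add_nonneg (cylinderWeight_nonneg hm1 _ _) (cylinderWeight_nonneg hm2 _ _)
    have hterm : ∀ A ∈ good k, ψ ((1 / 2) ^ 2 ^ (k + 1)) ≤ w A * Real.exp (-(k : ℝ)) := by
      intro A hA
      obtain ⟨q, hq, hqA⟩ := (Finset.mem_filter.1 hA).2
      have hqw : cylinderWeight q (A : Set ℕ) (2 ^ (k + 1)) ≤ w A := by
        have := cylinderWeight_nonneg hm1 (A : Set ℕ) (2 ^ (k + 1))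
        have := cylinderWeight_nonneg hm2 (A : Set ℕ) (2 ^ (k + 1))
        rcases hq with rfl | rfl <;> simp only [hw] <;> linarith
      push_cast at hdec
      refine hdec.trans ?_
      refine mul_le_mul (hqA.trans hqw) (Real.exp_le_exp.2 (by linarith)) (Real.exp_pos _).le
        (hw0 A)
    calc ∑ _A ∈ good k, ENNReal.ofReal (ψ ((1 / 2) ^ 2 ^ (k + 1)))
        ≤ ∑ A ∈ good k, ENNReal.ofReal (w A * Real.exp (-(k : ℝ))) :=
          Finset.sum_le_sum fun A hA => ENNReal.ofReal_le_ofReal (hterm A hA)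
      _ = ENNReal.ofReal (∑ A ∈ good k, w A * Real.exp (-(k : ℝ))) :=
          (ENNReal.ofReal_sum_of_nonneg fun A _ => mul_nonneg (hw0 A) (Real.exp_pos _).le).symm
      _ ≤ ENNReal.ofReal (2 * Real.exp (-(k : ℝ))) := by
          refine ENNReal.ofReal_le_ofReal ?_
          rw [← Finset.sum_mul]
          refine mul_le_mul_of_nonneg_right ?_ (Real.exp_pos _).le
          refine (Finset.sum_le_sum_of_subset_of_nonneg (Finset.filter_subset _ _)
            fun A _ _ => hw0 A).trans ?_
          rw [Finset.sum_add_distrib, sum_cylinderWeight, sum_cylinderWeight]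
          norm_num
  have hcover := Measure.mkMetric_le_liminf_tsum (β := ℕ)
    (ι := fun N => Σ j : ℕ, {A // A ∈ good (j + N)}) XiG (l := Filter.atTop)
    (fun N => ENNReal.ofReal ((1 / 2) ^ N)) (by
      rw [← ENNReal.ofReal_zero]
      exact ENNReal.tendsto_ofReal
        (tendsto_pow_atTop_nhds_zero_of_lt_one (by norm_num) (by norm_num)))
    (fun N i => Set.Icc (∑ j ∈ i.2.1, ((2 : ℝ) ^ j)⁻¹)
      (∑ j ∈ i.2.1, ((2 : ℝ) ^ j)⁻¹ + (1 / 2) ^ 2 ^ (i.1 + N + 1)))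
    (by
      refine Filter.Eventually.of_forall fun N i => ?_
      rw [Real.ediam_Icc, add_sub_cancel_left]
      refine ENNReal.ofReal_le_ofReal (pow_le_pow_of_le_one (by norm_num) (by norm_num) ?_)
      have := Nat.lt_two_pow_self (n := i.1 + N + 1)
      omega)
    (by
      refine Filter.eventually_atTop.2 ⟨K, fun N hN x hx => ?_⟩
      obtain ⟨a, ha, hlegal, rfl⟩ := hx
      obtain ⟨k, hk, q, hq, hqA⟩ := (hK N hN).1.2 {j | a j = 1} (by
        intro k hk h1 h2
        have := hlegal k hk
        rw [h1.out, h2.out] at this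
        omega)
      obtain ⟨j, rfl⟩ := Nat.exists_eq_add_of_le' hk
      refine Set.mem_iUnion.2 ⟨⟨j, {i ∈ Finset.Icc 1 (2 ^ (j + N + 1)) | a i = 1}, ?_⟩,
        mem_Icc_of_binary_expansion ha _⟩
      refine Finset.mem_filter.2 ⟨Finset.mem_powerset.2 (Finset.filter_subset _ _), q, hq,
        hqA.trans_eq (cylinderWeight_congr fun i h1 h2 => ?_)⟩
      simp [h1, h2])
    (fun d => ENNReal.ofReal (ψ d.toReal))
  refine le_antisymm (hcover.trans ?_) bot_le
  have htail : Filter.Tendsto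
      (fun N : ℕ => ∑' j : ℕ, ENNReal.ofReal (2 * Real.exp (-((j + N : ℕ) : ℝ))))
      Filter.atTop (nhds 0) := by
    refine ENNReal.tendsto_sum_nat_add
      (fun k : ℕ => ENNReal.ofReal (2 * Real.exp (-(k : ℝ)))) ?_
    exact (Real.summable_exp_neg_nat.mul_left 2).tsum_ofReal_ne_top
  rw [← htail.liminf_eq]
  refine Filter.liminf_le_liminf (Filter.eventually_atTop.2 ⟨K, fun N hN => ?_⟩)
  rw [ENNReal.tsum_sigma']
  refine ENNReal.tsum_le_tsum fun j => ?_
  simp only [Real.ediam_Icc, add_sub_cancel_left]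
  rw [ENNReal.toReal_ofReal (by positivity)]
  rw [Finset.tsum_subtype (good (j + N))
    (fun _ => ENNReal.ofReal (ψ ((1 / 2) ^ 2 ^ (j + N + 1))))]
  exact hsum (j + N) (by omega)

end
end

section
/- (Rogers–Taylor density theorem, symbolic version.) There exist constants 0 < c₁ ≤ c₂ < ∞ such that the following holds. Let P be a finite Borel measure on Σ₂, let Λ be a Borel subset of Σ₂ with P(Λ) > 0, let φ be any gauge function, and let β₁, β₂ ∈ [0,∞]. If for all x ∈ Λ, β₁ ≤ liminf_{n→∞} φ(2^{−n}) / P[x₁ⁿ] ≤ β₂, then c₁·β₁·P(Λ) ≤ H^φ(Λ) ≤ c₂·β₂·P(Λ). -/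
open MeasureTheory Filter Set
open scoped ENNReal

noncomputable section

/-- The symbolic space `Σ₂ = {0,1}^ℕ` (coordinates indexed from 0; coordinate `i` corresponds to
the paper's `x_{i+1}`). -/
def Sigma2 : Type := ℕ → Bool

/-- The metric `ρ(x,y) = 2^{-min{n : x_n ≠ y_n}}`. -/
noncomputable instance : MetricSpace Sigma2 := PiNat.metricSpace (E := fun _ => Bool)

instance : MeasurableSpace Sigma2 := borel Sigma2

instance : BorelSpace Sigma2 := ⟨rfl⟩

/-- The cylinder `[x₁…xₙ]`: sequences agreeing with `x` on the first `n` coordinates. -/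
def Cyl (x : Sigma2) (n : ℕ) : Set Sigma2 := {y : Sigma2 | ∀ i < n, y i = x i}

section

open Metric Topology

theorem Sigma2.mem_cyl_iff_dist_le {x y : Sigma2} {n : ℕ} :
    y ∈ Cyl x n ↔ dist y x ≤ (2 : ℝ) ^ (-(n : ℤ)) := by
  have h : ((2 : ℝ) ^ (-(n : ℤ))) = (1 / 2) ^ n := by simp
  rw [h]
  exact PiNat.mem_cylinder_iff_dist_le (E := fun _ => Bool)

theorem Sigma2.cyl_anti (x : Sigma2) {m n : ℕ} (h : m ≤ n) : Cyl x n ⊆ Cyl x m :=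
  fun _ hy i hi => hy i (hi.trans_le h)

theorem Sigma2.cyl_eq_of_mem {x y : Sigma2} {n : ℕ} (h : y ∈ Cyl x n) : Cyl y n = Cyl x n :=
  PiNat.mem_cylinder_iff_eq.1 h

theorem Sigma2.isOpen_cyl (x : Sigma2) (n : ℕ) : IsOpen (Cyl x n) :=
  PiNat.isOpen_cylinder (fun _ => Bool) x n

theorem Sigma2.self_mem_cyl (x : Sigma2) (n : ℕ) : x ∈ Cyl x n := fun _ _ => rfl

instance : TopologicalSpace.SeparableSpace Sigma2 :=
  inferInstanceAs (TopologicalSpace.SeparableSpace (ℕ → Bool))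

theorem Sigma2.two_zpow_le_dist_of_notMem_cyl {x y : Sigma2} {n : ℕ} (h : y ∉ Cyl x (n + 1)) :
    (2 : ℝ) ^ (-(n : ℤ)) ≤ dist y x := by
  have hne : y ≠ x := fun e => h (e ▸ Sigma2.self_mem_cyl x _)
  have h1 : dist y x = (1 / 2 : ℝ) ^ PiNat.firstDiff (E := fun _ => Bool) y x :=
    PiNat.dist_eq_of_ne (E := fun _ => Bool) hne
  have h2 : ¬ n + 1 ≤ PiNat.firstDiff (E := fun _ => Bool) y x := fun hle =>
    h ((PiNat.mem_cylinder_iff_le_firstDiff (E := fun _ => Bool) hne (n + 1)).2 hle)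
  have h3 : ((2 : ℝ) ^ (-(n : ℤ))) = (1 / 2) ^ n := by simp
  rw [h1, h3]
  exact pow_le_pow_of_le_one (by norm_num) (by norm_num) (by omega)

theorem Sigma2.ediam_cyl_le (x : Sigma2) (n : ℕ) :
    ediam (Cyl x n) ≤ ENNReal.ofReal ((2 : ℝ) ^ (-(n : ℤ))) := by
  refine ediam_le fun y hy z hz => ?_
  rw [edist_dist]
  refine ENNReal.ofReal_le_ofReal (Sigma2.mem_cyl_iff_dist_le.1 ?_)
  rwa [Sigma2.cyl_eq_of_mem hz]

theorem Sigma2.exists_cyl_subset {U : Set Sigma2} (hU : IsOpen U) {x : Sigma2} (hx : x ∈ U) :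
    ∃ n, Cyl x n ⊆ U := by
  obtain ⟨ε, hε, h⟩ := Metric.isOpen_iff.1 hU x hx
  obtain ⟨n, hn⟩ := exists_pow_lt_of_lt_one hε (by norm_num : (1 / 2 : ℝ) < 1)
  refine ⟨n, fun y hy => h ?_⟩
  have := Sigma2.mem_cyl_iff_dist_le.1 hy
  have h3 : ((2 : ℝ) ^ (-(n : ℤ))) = (1 / 2) ^ n := by simp
  exact (this.trans_eq h3).trans_lt hn

/-- A set of positive diameter containing `x` lies in a cylinder around `x` of no larger size. -/
theorem Sigma2.exists_subset_cyl_le_ediam {s : Set Sigma2} {x : Sigma2} (hx : x ∈ s)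
    (hs : ¬ s ⊆ {x}) :
    ∃ n : ℕ, s ⊆ Cyl x n ∧ ENNReal.ofReal ((2 : ℝ) ^ (-(n : ℤ))) ≤ ediam s := by
  classical
  have hex : ∃ n, ¬ s ⊆ Cyl x n := by
    by_contra! hall
    exact hs fun y hy => funext fun i => hall (i + 1) hy i (Nat.lt_succ_self i)
  have h0 : Nat.find hex ≠ 0 := fun h => by
    have := Nat.find_spec hex
    rw [h] at this
    exact this fun y _ i hi => absurd hi (Nat.not_lt_zero i)
  obtain ⟨n, hn⟩ := Nat.exists_eq_succ_of_ne_zero h0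
  refine ⟨n, not_not.1 (Nat.find_min hex (by omega)), ?_⟩
  have := Nat.find_spec hex
  rw [hn] at this
  obtain ⟨y, hy, hyn⟩ := Set.not_subset.1 this
  refine le_trans ?_ (edist_le_ediam_of_mem hy hx)
  rw [edist_dist]
  exact ENNReal.ofReal_le_ofReal (Sigma2.two_zpow_le_dist_of_notMem_cyl hyn)

theorem tendsto_two_zpow_neg_atTop :
    Tendsto (fun n : ℕ => (2 : ℝ) ^ (-(n : ℤ))) atTop (𝓝 0) := by
  simpa using tendsto_pow_atTop_nhds_zero_of_lt_one (r := (2 : ℝ)⁻¹) (by norm_num) (by norm_num)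

theorem IsGauge.tendsto_ofReal_two_zpow {φ : ℝ → ℝ} (hφ : IsGauge φ) :
    Tendsto (fun n : ℕ => ENNReal.ofReal (φ ((2 : ℝ) ^ (-(n : ℤ))))) atTop (𝓝 0) := by
  have h := (hφ.2.1 0 self_mem_Ici).tendsto.comp
    (tendsto_nhdsWithin_iff.2 ⟨tendsto_two_zpow_neg_atTop,
      Eventually.of_forall fun n => mem_Ici.2 (by positivity)⟩)
  rw [hφ.1] at h
  simpa using ENNReal.tendsto_ofReal h

theorem IsGauge.ofReal_le_of_ofReal_le {φ : ℝ → ℝ} (hφ : IsGauge φ) {a : ℝ} (ha : 0 ≤ a)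
    {d : ℝ≥0∞} (hd : d ≠ ⊤) (h : ENNReal.ofReal a ≤ d) :
    ENNReal.ofReal (φ a) ≤ ENNReal.ofReal (φ d.toReal) :=
  ENNReal.ofReal_le_ofReal <| hφ.2.2.monotoneOn ha ENNReal.toReal_nonneg
    ((ENNReal.ofReal_le_iff_le_toReal hd).1 h)

theorem IsGauge.le_of_le_ofReal {φ : ℝ → ℝ} (hφ : IsGauge φ) {a : ℝ} (ha : 0 ≤ a)
    {d : ℝ≥0∞} (h : d ≤ ENNReal.ofReal a) :
    ENNReal.ofReal (φ d.toReal) ≤ ENNReal.ofReal (φ a) :=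
  ENNReal.ofReal_le_ofReal <| hφ.2.2.monotoneOn ENNReal.toReal_nonneg ha
    (ENNReal.toReal_le_of_le_ofReal ha h)

/-- Mass distribution principle on `Σ₂`. -/
theorem IsGauge.mul_measure_le_gaugeMeasure {φ : ℝ → ℝ} (hφ : IsGauge φ) (P : Measure Sigma2)
    {t : ℝ≥0∞} {A : Set Sigma2} {N : ℕ}
    (hA : ∀ x ∈ A, ∀ n ≥ N, t * P (Cyl x n) ≤ ENNReal.ofReal (φ ((2 : ℝ) ^ (-(n : ℤ))))) :
    t * P A ≤ gaugeMeasure φ A := by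
  have key : t • OuterMeasure.restrict A P.toOuterMeasure ≤
      OuterMeasure.mkMetric fun d => ENNReal.ofReal (φ d.toReal) := by
    refine OuterMeasure.le_mkMetric _ _ (ENNReal.ofReal ((2 : ℝ) ^ (-(N : ℤ))))
      (ENNReal.ofReal_pos.2 (by positivity)) fun s hs => ?_
    simp only [_root_.smul_apply, OuterMeasure.restrict_apply, smul_eq_mul,
      Measure.coe_toOuterMeasure]
    rcases (s ∩ A).eq_empty_or_nonempty with he | ⟨x, hxs, hxA⟩
    · simp [he]
    by_cases hsx : s ⊆ {x}
    · have h0 : t * P (s ∩ A) ≤ 0 := by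
        refine ge_of_tendsto hφ.tendsto_ofReal_two_zpow ?_
        filter_upwards [eventually_ge_atTop N] with n hn
        refine le_trans ?_ (hA x hxA n hn)
        gcongr
        exact inter_subset_left.trans
          (hsx.trans (singleton_subset_iff.2 (Sigma2.self_mem_cyl x n)))
      exact h0.trans zero_le
    · obtain ⟨n, hsn, hn⟩ := Sigma2.exists_subset_cyl_le_ediam hxs hsx
      have hNn : N ≤ n := by
        have h := (ENNReal.ofReal_le_ofReal_iff (by positivity)).1 (hn.trans hs)
        have := (zpow_le_zpow_iff_right₀ (by norm_num : (1 : ℝ) < 2)).1 h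
        omega
      calc t * P (s ∩ A) ≤ t * P (Cyl x n) := by
            gcongr
            exact inter_subset_left.trans hsn
        _ ≤ ENNReal.ofReal (φ ((2 : ℝ) ^ (-(n : ℤ)))) := hA x hxA n hNn
        _ ≤ _ := hφ.ofReal_le_of_ofReal_le (by positivity)
            (ne_top_of_le_ne_top ENNReal.ofReal_ne_top hs) hn
  have := key A
  simpa [OuterMeasure.coe_mkMetric, gaugeMeasure] using this

theorem IsGauge.gaugeMeasure_le_mul_of_isOpen {φ : ℝ → ℝ} (hφ : IsGauge φ) (P : Measure Sigma2)
    {t : ℝ≥0∞} {A U : Set Sigma2} (hU : IsOpen U) (hAU : A ⊆ U)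
    (hA : ∀ x ∈ A, ∃ᶠ n : ℕ in atTop,
      ENNReal.ofReal (φ ((2 : ℝ) ^ (-(n : ℤ)))) ≤ t * P (Cyl x n)) :
    gaugeMeasure φ A ≤ t * P U := by
  classical
  -- Cylinders of generation at least `k` that are admissible at `x`.
  let good (k : ℕ) (x : Sigma2) (n : ℕ) : Prop :=
    k ≤ n ∧ Cyl x n ⊆ U ∧ ENNReal.ofReal (φ ((2 : ℝ) ^ (-(n : ℤ)))) ≤ t * P (Cyl x n)
  have hgood : ∀ k x, x ∈ A → ∃ n, good k x n := by
    intro k x hx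
    obtain ⟨m, hm⟩ := Sigma2.exists_cyl_subset hU (hAU hx)
    obtain ⟨n, hn, h⟩ := frequently_atTop.1 (hA x hx) (max k m)
    exact ⟨n, (le_max_left _ _).trans hn,
      (Sigma2.cyl_anti x ((le_max_right _ _).trans hn)).trans hm, h⟩
  let F (k : ℕ) : Set (Set Sigma2) :=
    {C | ∃ x n, good k x n ∧ (∀ m < n, ¬ good k x m) ∧ C = Cyl x n}
  have good_congr : ∀ {k x y n}, Cyl x n = Cyl y n → good k x n → good k y n := by
    intro k x y n h hg
    simpa only [good, h] using hg
  have hF : ∀ k, (F k).PairwiseDisjoint id := by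
    rintro k _ ⟨x, m, hm, hm', rfl⟩ _ ⟨y, n, hn, hn', rfl⟩ hne
    rw [Function.onFun, id, id, Set.disjoint_left]
    intro z hzx hzy
    have e₁ := Sigma2.cyl_eq_of_mem hzx
    have e₂ := Sigma2.cyl_eq_of_mem hzy
    have cyl_eq : ∀ {l}, l ≤ m → l ≤ n → Cyl x l = Cyl y l := fun h₁ h₂ =>
      (Sigma2.cyl_eq_of_mem (Sigma2.cyl_anti x h₁ hzx)).symm.trans
        (Sigma2.cyl_eq_of_mem (Sigma2.cyl_anti y h₂ hzy))
    rcases lt_trichotomy m n with h | h | h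
    · exact hn' m h (good_congr (cyl_eq le_rfl h.le) hm)
    · subst h
      exact hne (e₁.symm.trans e₂)
    · exact hm' n h (good_congr (cyl_eq h.le le_rfl).symm hn)
  have hopen : ∀ k, ∀ C ∈ F k, IsOpen C := by
    rintro k _ ⟨x, n, -, -, rfl⟩
    exact Sigma2.isOpen_cyl x n
  have hcount : ∀ k, (F k).Countable := fun k =>
    (hF k).countable_of_isOpen (hopen k) (by
      rintro _ ⟨x, n, -, -, rfl⟩
      exact ⟨x, Sigma2.self_mem_cyl x n⟩)
  have : ∀ k, Countable (F k) := fun k => (hcount k).to_subtype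
  have hsum : ∀ k, ∑' C : F k, ENNReal.ofReal (φ (ediam (C : Set Sigma2)).toReal) ≤ t * P U := by
    intro k
    calc ∑' C : F k, ENNReal.ofReal (φ (ediam (C : Set Sigma2)).toReal)
        ≤ ∑' C : F k, t * P C := by
          refine ENNReal.tsum_le_tsum ?_
          rintro ⟨_, x, n, hg, -, rfl⟩
          exact (hφ.le_of_le_ofReal (by positivity) (Sigma2.ediam_cyl_le x n)).trans hg.2.2
      _ = t * P (⋃ C ∈ F k, id C) := by
          rw [ENNReal.tsum_mul_left,
            measure_biUnion (hcount k) (hF k) fun C hC => (hopen k C hC).measurableSet]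
          rfl
      _ ≤ t * P U := by
          gcongr
          refine iUnion₂_subset ?_
          rintro _ ⟨x, n, hg, -, rfl⟩
          exact hg.2.1
  refine (Measure.mkMetric_le_liminf_tsum (l := atTop) A
    (fun k : ℕ => ENNReal.ofReal ((2 : ℝ) ^ (-(k : ℤ)))) ?_
    (fun k (C : F k) => (C : Set Sigma2)) ?_ ?_ _).trans ?_
  · simpa using ENNReal.tendsto_ofReal tendsto_two_zpow_neg_atTop
  · refine Eventually.of_forall fun k => ?_
    rintro ⟨_, x, n, hg, -, rfl⟩
    refine (ediam_mono (Sigma2.cyl_anti x hg.1)).trans (Sigma2.ediam_cyl_le x k)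
  · refine Eventually.of_forall fun k x hx => ?_
    have h := hgood k x hx
    exact mem_iUnion.2 ⟨⟨Cyl x (Nat.find h), x, Nat.find h, Nat.find_spec h,
      fun m hm => Nat.find_min h hm, rfl⟩, Sigma2.self_mem_cyl x _⟩
  · exact (liminf_le_liminf (Eventually.of_forall hsum)).trans_eq (liminf_const _)

end

/-- Rogers–Taylor density theorem, symbolic version: there are absolute constants
`0 < c₁ ≤ c₂ < ∞` such that for every finite Borel measure `P` on `Σ₂`, every Borel set `Λ`
with `P(Λ) > 0`, every gauge `φ` and every `β₁, β₂ ∈ [0,∞]`: if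
`β₁ ≤ liminf_n φ(2^{-n})/P[x₁ⁿ] ≤ β₂` for all `x ∈ Λ`, then
`c₁·β₁·P(Λ) ≤ H^φ(Λ) ≤ c₂·β₂·P(Λ)`. -/
theorem rogers_taylor_density :
    ∃ c₁ c₂ : ℝ≥0∞, 0 < c₁ ∧ c₁ ≤ c₂ ∧ c₂ < ⊤ ∧
      ∀ (P : Measure Sigma2), IsFiniteMeasure P →
      ∀ Λ : Set Sigma2, MeasurableSet Λ → 0 < P Λ →
      ∀ φ : ℝ → ℝ, IsGauge φ →
      ∀ β₁ β₂ : ℝ≥0∞,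
      (∀ x ∈ Λ,
        β₁ ≤ liminf (fun n : ℕ => ENNReal.ofReal (φ ((2 : ℝ) ^ (-(n : ℤ)))) / P (Cyl x n)) atTop ∧
        liminf (fun n : ℕ => ENNReal.ofReal (φ ((2 : ℝ) ^ (-(n : ℤ)))) / P (Cyl x n)) atTop ≤ β₂) →
      c₁ * β₁ * P Λ ≤ gaugeMeasure φ Λ ∧ gaugeMeasure φ Λ ≤ c₂ * β₂ * P Λ := by
  refine ⟨1, 1, one_pos, le_rfl, ENNReal.one_lt_top, ?_⟩
  intro P hP Λ _ hΛ φ hφ β₁ β₂ h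
  rw [one_mul, one_mul]
  have hΛtop : P Λ ≠ ⊤ := measure_ne_top P Λ
  constructor
  · rw [← ENNReal.le_div_iff_mul_le (Or.inl hΛ.ne') (Or.inl hΛtop)]
    refine le_of_forall_lt_imp_le_of_dense fun t ht => ?_
    rw [ENNReal.le_div_iff_mul_le (Or.inl hΛ.ne') (Or.inl hΛtop)]
    let A (N : ℕ) : Set Sigma2 :=
      {x ∈ Λ | ∀ n ≥ N, t * P (Cyl x n) ≤ ENNReal.ofReal (φ ((2 : ℝ) ^ (-(n : ℤ))))}
    have hmono : Monotone A := fun M N hMN x hx =>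
      ⟨hx.1, fun n hn => hx.2 n (le_trans hMN hn)⟩
    have hU : ⋃ N, A N = Λ := by
      refine Subset.antisymm (iUnion_subset fun N x hx => hx.1) fun x hx => ?_
      obtain ⟨N, hN⟩ := eventually_atTop.1 (eventually_lt_of_lt_liminf (ht.trans_le (h x hx).1))
      exact mem_iUnion.2 ⟨N, hx, fun n hn => ENNReal.mul_le_of_le_div (hN n hn).le⟩
    rw [← hU, hmono.measure_iUnion, ENNReal.mul_iSup, hU]
    exact iSup_le fun N => (hφ.mul_measure_le_gaugeMeasure P fun x hx => hx.2).trans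
      (measure_mono fun x hx => hx.1)
  · rw [← ENNReal.div_le_iff hΛ.ne' hΛtop]
    refine le_of_forall_gt_imp_ge_of_dense fun t ht => ?_
    rcases eq_or_ne t ⊤ with rfl | htop
    · exact le_top
    have ht0 : t ≠ 0 := (zero_le.trans_lt ht).ne'
    rw [ENNReal.div_le_iff hΛ.ne' hΛtop, mul_comm, ← ENNReal.div_le_iff ht0 htop]
    refine le_of_forall_gt_imp_ge_of_dense fun r hr => ?_
    obtain ⟨U, hΛU, hU, hUr⟩ := Λ.exists_isOpen_lt_of_lt r hr
    rw [ENNReal.div_le_iff ht0 htop, mul_comm]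
    refine (hφ.gaugeMeasure_le_mul_of_isOpen P hU hΛU fun x hx => ?_).trans
      (mul_le_mul_right hUr.le t)
    refine (frequently_lt_of_liminf_lt (by isBoundedDefault) ((h x hx).2.trans_lt ht)).mono
      fun n hn => ?_
    exact (ENNReal.div_le_iff_le_mul (Or.inr htop) (Or.inr ht0)).1 hn.le

end
end

section
/- For every r ∈ (0,1) and every k ≥ 1, the entropy of the partition of Σ_G into cylinders of length k with respect to μ(r) satisfies H^{μ(r)}(α_k) = H(r)·F_{k−1}(r), where H^{μ(r)}(α_k) = −Σ_u μ(r)[u] log₂ μ(r)[u], the sum being over all admissible words u of length k. -/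
open scoped Classical

noncomputable section

/-- Binary entropy function `H(r) = -r log₂ r - (1-r) log₂ (1-r)`. -/
def Hent (r : ℝ) : ℝ := -r * Real.logb 2 r - (1 - r) * Real.logb 2 (1 - r)

/-- The polynomials `F₀(x) = 1`, `F₁(x) = 1 + x`,
`F_k(x) = 1 + x F_{k-1}(x) + (1-x) F_{k-2}(x)` for `k ≥ 2`. -/
def Fpoly : ℕ → ℝ → ℝ
  | 0, _ => 1
  | 1, x => 1 + x
  | (k + 2), x => 1 + x * Fpoly (k + 1) x + (1 - x) * Fpoly k x

/-- Number of occurrences of the symbol `1` among the first `k` letters of `w`. -/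
def Ncount1 (w : ℕ → Bool) (k : ℕ) : ℕ := ((Finset.range k).filter fun j => w j = true).card

/-- Number of occurrences of the symbol `0` among the first `k` letters of `w`. -/
def Ncount0 (w : ℕ → Bool) (k : ℕ) : ℕ := ((Finset.range k).filter fun j => w j = false).card

/-- A word of length `k` is admissible (for the golden mean shift) if no two consecutive
letters equal `1`. -/
def Admissible (w : ℕ → Bool) (k : ℕ) : Prop :=
  ∀ j, j + 1 < k → ¬(w j = true ∧ w (j + 1) = true)

/-- The Markov measure `μ(r)` of the cylinder of the word `w₀ … w_{k-1}`:
`μ(r)[u] = (1-r)^{N₁(u₁…u_k)} · r^{N₀(u₁…u_k) - N₁(u₁…u_{k-1})}` for admissible words,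
and `0` otherwise. -/
def markovCylProb (r : ℝ) (w : ℕ → Bool) (k : ℕ) : ℝ :=
  if Admissible w k then
    (1 - r) ^ Ncount1 w k * r ^ ((Ncount0 w k : ℤ) - (Ncount1 w (k - 1) : ℤ))
  else 0

lemma Ncount1_zero (w : ℕ → Bool) : Ncount1 w 0 = 0 := by simp [Ncount1]

lemma Ncount0_zero (w : ℕ → Bool) : Ncount0 w 0 = 0 := by simp [Ncount0]

lemma Ncount1_succ (w : ℕ → Bool) (k : ℕ) :
    Ncount1 w (k + 1) = Ncount1 (fun j => w (j + 1)) k + if w 0 = true then 1 else 0 := by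
  simp only [Ncount1, Finset.card_filter]
  exact Finset.sum_range_succ' _ _

lemma Ncount0_succ (w : ℕ → Bool) (k : ℕ) :
    Ncount0 w (k + 1) = Ncount0 (fun j => w (j + 1)) k + if w 0 = false then 1 else 0 := by
  simp only [Ncount0, Finset.card_filter]
  exact Finset.sum_range_succ' _ _

lemma admissible_succ_of_false {w : ℕ → Bool} (h : w 0 = false) (k : ℕ) :
    Admissible w (k + 1) ↔ Admissible (fun j => w (j + 1)) k := by
  refine ⟨fun H j hj => H (j + 1) (by omega), fun H j hj => ?_⟩
  cases j with
  | zero => simp [h]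
  | succ j => exact H j (by omega)

lemma admissible_add_two {w : ℕ → Bool} (k : ℕ) :
    Admissible w (k + 2) ↔
      ¬(w 0 = true ∧ w 1 = true) ∧ Admissible (fun j => w (j + 1)) (k + 1) := by
  refine ⟨fun H => ⟨H 0 (by omega), fun j hj => H (j + 1) (by omega)⟩, fun H j hj => ?_⟩
  cases j with
  | zero => exact H.1
  | succ j => exact H.2 j (by omega)

lemma markovCylProb_zero (r : ℝ) (w : ℕ → Bool) : markovCylProb r w 0 = 1 := by
  have : Admissible w 0 := fun j hj => by omega
  simp [markovCylProb, this, Ncount1_zero, Ncount0_zero]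

lemma markovCylProb_succ_of_false {r : ℝ} (hr : r ≠ 0) {w : ℕ → Bool} (h : w 0 = false) (k : ℕ) :
    markovCylProb r w (k + 1) = r * markovCylProb r (fun j => w (j + 1)) k := by
  have hpred : Ncount1 w k = Ncount1 (fun j => w (j + 1)) (k - 1) := by
    cases k with
    | zero => simp [Ncount1_zero]
    | succ k => simp [Ncount1_succ w, h]
  simp only [markovCylProb, admissible_succ_of_false h, Nat.add_sub_cancel, hpred,
    Ncount1_succ w k, Ncount0_succ w k, h, Bool.false_eq_true, if_true, if_false, add_zero]
  split_ifs
  · push_cast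
    rw [add_sub_right_comm, zpow_add_one₀ hr]
    ring
  · simp

lemma markovCylProb_one_of_true {r : ℝ} {w : ℕ → Bool} (h : w 0 = true) :
    markovCylProb r w 1 = 1 - r := by
  have : Admissible w 1 := fun j hj => by omega
  simp [markovCylProb, this, Ncount1_succ, Ncount0_succ, Ncount1_zero, Ncount0_zero, h]

lemma markovCylProb_add_two_of_true_true {r : ℝ} {w : ℕ → Bool} (h₀ : w 0 = true)
    (h₁ : w 1 = true) (k : ℕ) : markovCylProb r w (k + 2) = 0 := by
  simp [markovCylProb, admissible_add_two, h₀, h₁]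

lemma markovCylProb_add_two_of_true_false {r : ℝ} {w : ℕ → Bool} (h₀ : w 0 = true)
    (h₁ : w 1 = false) (k : ℕ) :
    markovCylProb r w (k + 2) = (1 - r) * markovCylProb r (fun j => w (j + 2)) k := by
  have hadm : Admissible w (k + 2) ↔ Admissible (fun j => w (j + 2)) k := by
    rw [admissible_add_two, admissible_succ_of_false h₁]
    simp [h₁]
  have hpred : Ncount1 w (k + 1) = Ncount1 (fun j => w (j + 2)) (k - 1) + 1 := by
    cases k with
    | zero => simp [Ncount1_succ, Ncount1_zero, h₀]
    | succ k => simp [Ncount1_succ _ (_ + 1), Ncount1_succ _ k, h₀, h₁]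
  have hone : Ncount1 w (k + 2) = Ncount1 (fun j => w (j + 2)) k + 1 := by
    simp [Ncount1_succ w, Ncount1_succ (fun j => w (j + 1)), h₀, h₁]
  have hzero : Ncount0 w (k + 2) = Ncount0 (fun j => w (j + 2)) k + 1 := by
    simp [Ncount0_succ w, Ncount0_succ (fun j => w (j + 1)), h₀, h₁]
  simp only [markovCylProb, hadm, hone, hzero, show k + 2 - 1 = k + 1 from rfl, hpred]
  split_ifs
  · push_cast
    rw [add_sub_add_right_eq_sub]
    ring
  · simp

/-- The sum of `f (μ(r)[u])` over all words `u` of length `k`. -/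
def cylSum (r : ℝ) (f : ℝ → ℝ) (k : ℕ) : ℝ :=
  ∑ u : Fin k → Bool, f (markovCylProb r (fun j => if h : j < k then u ⟨j, h⟩ else false) k)

lemma sum_fin_succ_bool {M : Type*} [AddCommMonoid M] (k : ℕ) (g : (Fin (k + 1) → Bool) → M) :
    ∑ u, g u =
      ∑ u : Fin k → Bool, g (Fin.cons true u) + ∑ u : Fin k → Bool, g (Fin.cons false u) := by
  rw [← (Fin.consEquiv fun _ : Fin (k + 1) => Bool).sum_comp, Fintype.sum_prod_type]
  simp [Fin.consEquiv]

lemma cylSum_zero (r : ℝ) (f : ℝ → ℝ) : cylSum r f 0 = f 1 := by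
  simp [cylSum, markovCylProb_zero]

lemma extend_cons_succ {k : ℕ} (b : Bool) (u : Fin k → Bool) (j : ℕ) :
    (if h : j + 1 < k + 1 then (Fin.cons b u : Fin (k + 1) → Bool) ⟨j + 1, h⟩ else false) =
      if h : j < k then u ⟨j, h⟩ else false := by
  by_cases h : j < k
  · simp only [h, Nat.add_lt_add_right h 1, dif_pos]
    exact Fin.cons_succ (α := fun _ => Bool) b u ⟨j, h⟩
  · simp [h]

lemma sum_cons_false {r : ℝ} (hr : r ≠ 0) (f : ℝ → ℝ) (k : ℕ) :
    ∑ u : Fin k → Bool, f (markovCylProb r (fun j => if h : j < k + 1 then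
      (Fin.cons false u : Fin (k + 1) → Bool) ⟨j, h⟩ else false) (k + 1)) =
      cylSum r (fun p => f (r * p)) k := by
  refine Finset.sum_congr rfl fun u _ => ?_
  rw [markovCylProb_succ_of_false hr (by simp)]
  simp only [extend_cons_succ]

lemma cylSum_one {r : ℝ} (hr : r ≠ 0) (f : ℝ → ℝ) : cylSum r f 1 = f (1 - r) + f r := by
  rw [cylSum, sum_fin_succ_bool, sum_cons_false hr, cylSum_zero, mul_one]
  congr 1
  simp [markovCylProb_one_of_true]

lemma cylSum_add_two {r : ℝ} (hr : r ≠ 0) {f : ℝ → ℝ} (hf : f 0 = 0) (k : ℕ) :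
    cylSum r f (k + 2) =
      cylSum r (fun p => f ((1 - r) * p)) k + cylSum r (fun p => f (r * p)) (k + 1) := by
  rw [cylSum, sum_fin_succ_bool, sum_cons_false hr, sum_fin_succ_bool]
  congr 1
  rw [Finset.sum_eq_zero, zero_add]
  · refine Finset.sum_congr rfl fun u _ => ?_
    rw [markovCylProb_add_two_of_true_false (by simp)
      (by rw [extend_cons_succ]; simp)]
    simp only [extend_cons_succ]
  · intro u _
    rw [markovCylProb_add_two_of_true_true (by simp) (by rw [extend_cons_succ]; simp), hf]

lemma cylSum_mul_left (r c : ℝ) (f : ℝ → ℝ) (k : ℕ) :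
    cylSum r (fun p => c * f p) k = c * cylSum r f k := by
  simp [cylSum, Finset.mul_sum]

lemma cylSum_add (r : ℝ) (f g : ℝ → ℝ) (k : ℕ) :
    cylSum r (fun p => f p + g p) k = cylSum r f k + cylSum r g k := by
  simp [cylSum, Finset.sum_add_distrib]

/-- The cylinder probabilities of length `k` sum to one. -/
lemma cylSum_id {r : ℝ} (hr : r ≠ 0) (k : ℕ) : cylSum r (fun p => p) k = 1 := by
  induction k using Nat.twoStepInduction with
  | zero => rw [cylSum_zero]
  | one => rw [cylSum_one hr]; ring
  | more k ih₀ ih₁ =>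
    rw [cylSum_add_two hr rfl, cylSum_mul_left, cylSum_mul_left, ih₀, ih₁]
    ring

lemma const_mul_logb {c : ℝ} (hc : c ≠ 0) (p : ℝ) :
    c * p * Real.logb 2 (c * p) = c * Real.logb 2 c * p + c * (p * Real.logb 2 p) := by
  rcases eq_or_ne p 0 with rfl | hp
  · simp
  · rw [Real.logb_mul hc hp]
    ring

lemma cylSum_const_mul_logb {r c : ℝ} (hr : r ≠ 0) (hc : c ≠ 0) (k : ℕ) :
    cylSum r (fun p => c * p * Real.logb 2 (c * p)) k =
      c * Real.logb 2 c + c * cylSum r (fun p => p * Real.logb 2 p) k := by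
  simp only [const_mul_logb hc]
  rw [cylSum_add, cylSum_mul_left, cylSum_mul_left, cylSum_id hr, mul_one]

/-- The entropies of the cylinder partitions satisfy a two-step linear recursion. -/
lemma cylSum_mul_logb_add_two {r : ℝ} (hr : r ∈ Set.Ioo (0 : ℝ) 1) (k : ℕ) :
    cylSum r (fun p => p * Real.logb 2 p) (k + 2) =
      -Hent r + r * cylSum r (fun p => p * Real.logb 2 p) (k + 1) +
        (1 - r) * cylSum r (fun p => p * Real.logb 2 p) k := by
  have h₀ : r ≠ 0 := hr.1.ne'
  rw [cylSum_add_two h₀ (by simp), cylSum_const_mul_logb h₀ h₀,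
    cylSum_const_mul_logb h₀ (sub_pos.2 hr.2).ne', Hent]
  ring

lemma cylSum_mul_logb_succ {r : ℝ} (hr : r ∈ Set.Ioo (0 : ℝ) 1) (k : ℕ) :
    cylSum r (fun p => p * Real.logb 2 p) (k + 1) = -(Hent r * Fpoly k r) := by
  have h₁ : cylSum r (fun p => p * Real.logb 2 p) 1 = -Hent r := by
    rw [cylSum_one hr.1.ne', Hent]
    ring
  induction k using Nat.twoStepInduction with
  | zero => simp [h₁, Fpoly]
  | one =>
    rw [cylSum_mul_logb_add_two hr, h₁, cylSum_zero, Fpoly, Real.logb_one]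
    ring
  | more k ih₀ ih₁ =>
    rw [cylSum_mul_logb_add_two hr, ih₀, ih₁, Fpoly]
    ring

/-- Entropy of the partition of the golden mean shift into cylinders of length `k` with respect to `μ(r)`:
`H^{μ(r)}(α_k) = H(r) · F_{k-1}(r)`. The sum ranges over all words of length `k`;
non-admissible words have `μ(r)[u] = 0` and contribute `0`. -/
theorem entropy_partition_eq (r : ℝ) (hr : r ∈ Set.Ioo (0 : ℝ) 1) (k : ℕ) (hk : 1 ≤ k) :
    -(∑ u : Fin k → Bool,
        markovCylProb r (fun j => if h : j < k then u ⟨j, h⟩ else false) k *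
          Real.logb 2 (markovCylProb r (fun j => if h : j < k then u ⟨j, h⟩ else false) k))
      = Hent r * Fpoly (k - 1) r := by
  obtain ⟨k, rfl⟩ := Nat.exists_eq_add_of_le' hk
  rw [Nat.add_sub_cancel, ← neg_eq_iff_eq_neg.2 (cylSum_mul_logb_succ hr k), cylSum]

end
end

section
/- For every k ≥ 0 and every real x ≠ 2, F_k(x) = ((x−1)^{k+2} − (k+2)x + (2k+3)) / (x−2)². -/
open scoped Classical

noncomputable section

/-- Division-free form of the explicit formula, valid for every `x`. -/
theorem Fpoly_mul_sq (k : ℕ) (x : ℝ) :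
    Fpoly k x * (x - 2) ^ 2 = (x - 1) ^ (k + 2) - (k + 2) * x + (2 * k + 3) := by
  induction k using Nat.twoStepInduction with
  | zero => simp only [Fpoly]; push_cast; ring
  | one => simp only [Fpoly]; push_cast; ring
  | more k ih ih' =>
    simp only [Fpoly]
    push_cast at ih' ⊢
    linear_combination x * ih' + (1 - x) * ih

/-- Explicit formula: `F_k(x) = ((x-1)^{k+2} - (k+2)x + (2k+3)) / (x-2)²`. -/
theorem Fpoly_eq (k : ℕ) (x : ℝ) (hx : x ≠ 2) :
    Fpoly k x = ((x - 1) ^ (k + 2) - (k + 2) * x + (2 * k + 3)) / (x - 2) ^ 2 := by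
  rw [eq_div_iff (pow_ne_zero 2 (sub_ne_zero.mpr hx))]
  exact Fpoly_mul_sq k x

end
end

section
/- For every r ∈ (0,1), H(r)·Σ_{k=1}^∞ 2^{−(k+1)} F_{k−1}(r) = 2H(r)/(3−r); moreover, the function A(r) = 2H(r)/(3−r) on (0,1) attains its maximum at the unique p ∈ (0,1) with p³ = (1−p)², i.e., A(r) ≤ A(p) = −log₂ p for all r ∈ (0,1). -/
open scoped Classical

noncomputable section

theorem Fpoly_mem_Icc {r : ℝ} (hr : r ∈ Set.Ioo (0 : ℝ) 1) :
    ∀ k : ℕ, Fpoly k r ∈ Set.Icc (0 : ℝ) (k + 1)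
  | 0 => by simp [Fpoly]
  | 1 => by
    obtain ⟨h0, h1⟩ := hr
    simp only [Fpoly, Set.mem_Icc, Nat.cast_one]
    constructor <;> linarith
  | (k + 2) => by
    obtain ⟨a0, a1⟩ := Fpoly_mem_Icc hr (k + 1)
    obtain ⟨b0, b1⟩ := Fpoly_mem_Icc hr k
    obtain ⟨h0, h1⟩ := hr
    have hs : 0 < 1 - r := sub_pos.2 h1
    simp only [Fpoly, Set.mem_Icc]
    push_cast at a1 ⊢
    have h2 := mul_le_mul_of_nonneg_left a1 h0.le
    have h3 := mul_le_mul_of_nonneg_left b1 hs.le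
    exact ⟨by positivity, by nlinarith⟩

theorem summable_Fpoly_div_two_pow {r : ℝ} (hr : r ∈ Set.Ioo (0 : ℝ) 1) :
    Summable fun k : ℕ => Fpoly k r / 2 ^ k := by
  have hg : Summable fun k : ℕ => ((k : ℝ) + 1) * (1 / 2) ^ k := by
    have h1 : Summable fun k : ℕ => (k : ℝ) * (1 / 2) ^ k := by
      simpa using summable_pow_mul_geometric_of_norm_lt_one 1
        (by norm_num : ‖(1 / 2 : ℝ)‖ < 1)
    simpa [add_mul] using h1.add summable_geometric_two
  refine Summable.of_nonneg_of_le
    (fun k => div_nonneg (Fpoly_mem_Icc hr k).1 (by positivity)) (fun k => ?_) hg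
  rw [one_div, inv_pow, ← div_eq_mul_inv]
  exact div_le_div_of_nonneg_right (Fpoly_mem_Icc hr k).2 (by positivity)

theorem tsum_Fpoly_div_two_pow {r : ℝ} (hr : r ∈ Set.Ioo (0 : ℝ) 1) :
    ∑' k : ℕ, Fpoly k r / 2 ^ k = 8 / (3 - r) := by
  have hs := summable_Fpoly_div_two_pow hr
  have hs1 := (summable_nat_add_iff 1).2 hs
  have e1 := hs.tsum_eq_zero_add
  have e2 := hs1.tsum_eq_zero_add
  have e3 : ∑' k : ℕ, Fpoly (k + 1 + 1) r / 2 ^ (k + 1 + 1)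
      = 1 / 4 * ∑' k : ℕ, (1 / 2 : ℝ) ^ k + r / 2 * ∑' k : ℕ, Fpoly (k + 1) r / 2 ^ (k + 1)
        + (1 - r) / 4 * ∑' k : ℕ, Fpoly k r / 2 ^ k := by
    rw [← tsum_mul_left, ← tsum_mul_left, ← tsum_mul_left,
      ← (summable_geometric_two.mul_left _).tsum_add (hs1.mul_left _),
      ← ((summable_geometric_two.mul_left _).add (hs1.mul_left _)).tsum_add (hs.mul_left _)]
    refine tsum_congr fun k => ?_
    simp only [Fpoly, one_div, inv_pow, pow_succ]
    field_simp
    ring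
  rw [e3, tsum_geometric_two] at e2
  simp only [Fpoly, zero_add, pow_zero, pow_one, div_one] at e1 e2
  have hr' : 0 < 3 - r := by linarith [hr.2]
  rw [eq_div_iff hr'.ne']
  linear_combination 4 * e2 + (4 - 2 * r) * e1

/-- Gibbs' inequality for two Bernoulli distributions. -/
theorem Hent_le_cross_entropy {p r : ℝ} (hp : p ∈ Set.Ioo (0 : ℝ) 1)
    (hr : r ∈ Set.Ioo (0 : ℝ) 1) :
    Hent r ≤ -r * Real.logb 2 p - (1 - r) * Real.logb 2 (1 - p) := by
  have aux {x y : ℝ} (hx : 0 < x) (hy : 0 < y) :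
      x * (Real.log y - Real.log x) ≤ y - x := by
    rw [← Real.log_div hy.ne' hx.ne']
    calc x * Real.log (y / x) ≤ x * (y / x - 1) :=
          mul_le_mul_of_nonneg_left (Real.log_le_sub_one_of_pos (by positivity)) hx.le
      _ = y - x := by field_simp
  have h1 := aux hr.1 hp.1
  have h2 := aux (sub_pos.2 hr.2) (sub_pos.2 hp.2)
  have hl : 0 < Real.log 2 := Real.log_pos one_lt_two
  simp only [Hent, Real.logb, mul_div_assoc', ← sub_div]
  gcongr ?_ / _
  linarith

theorem logb_one_sub_of_pow_three_eq {p : ℝ} (hpe : p ^ 3 = (1 - p) ^ 2) :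
    Real.logb 2 (1 - p) = 3 / 2 * Real.logb 2 p := by
  have h := congrArg (Real.logb 2) hpe
  rw [Real.logb_pow, Real.logb_pow] at h
  push_cast at h
  linarith

/-- For `r ∈ (0,1)`, `H(r)·∑_{k≥1} 2^{-(k+1)} F_{k-1}(r) = 2H(r)/(3-r)`, and the function
`A(r) = 2H(r)/(3-r)` attains its maximum on `(0,1)` at the root `p` of `p³=(1-p)²`, with
`A(p) = -log₂ p` (the first sum is reindexed by `k ↦ k+1`). -/
theorem sum_Fpoly_and_max (p : ℝ) (hp : p ∈ Set.Ioo (0 : ℝ) 1)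
    (hpe : p ^ 3 = (1 - p) ^ 2) :
    (∀ r ∈ Set.Ioo (0 : ℝ) 1,
      Hent r * ∑' k : ℕ, Fpoly k r / 2 ^ (k + 2) = 2 * Hent r / (3 - r)) ∧
    (∀ r ∈ Set.Ioo (0 : ℝ) 1, 2 * Hent r / (3 - r) ≤ 2 * Hent p / (3 - p)) ∧
    2 * Hent p / (3 - p) = -Real.logb 2 p := by
  have hq := logb_one_sub_of_pow_three_eq hpe
  have hmax : 2 * Hent p / (3 - p) = -Real.logb 2 p := by
    have h3 : 0 < 3 - p := by linarith [hp.2]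
    rw [div_eq_iff h3.ne', Hent, hq]
    ring
  refine ⟨fun r hr => ?_, fun r hr => ?_, hmax⟩
  · have h : ∑' k : ℕ, Fpoly k r / 2 ^ (k + 2) = 2 / (3 - r) := by
      simp only [pow_add, ← div_div]
      rw [tsum_div_const, tsum_Fpoly_div_two_pow hr]
      ring
    rw [h]
    ring
  · have h3 : 0 < 3 - r := by linarith [hr.2]
    rw [hmax, div_le_iff₀ h3]
    have h := Hent_le_cross_entropy hp hr
    rw [hq] at h
    linarith

end
end

section
/- Let 1 < η < 2 and let (γ(n))_{n≥1} be a real sequence with sup_n |γ(n) − γ(n−1)| < ∞, and suppose there is n₀ such that for all n ≥ n₀, γ(n) ≥ γ(2n)/2 + n/(log₂(2n))^η. Then either there exists c > 0 such that for all n ≥ n₀, γ(2n) ≥ c·2n/(log₂(2n))^{η−1}, or there exists ε > 0 such that for infinitely many n, both γ(2n) ≤ −εn and γ(n) − γ(2n)/2 ≤ n/log₂(2n). -/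
theorem logb_two_mul_two_pow_mul {m : ℕ} (hm : 1 ≤ m) (k : ℕ) :
    Real.logb 2 (2 * ((2 ^ k * m : ℕ) : ℝ)) = k + 1 + Real.logb 2 m := by
  have hm' : (m : ℝ) ≠ 0 := by positivity
  have e : (2 * ((2 ^ k * m : ℕ) : ℝ)) = 2 ^ (k + 1) * m := by push_cast; ring
  rw [e, Real.logb_mul (by positivity) hm', Real.logb_pow, Real.logb_self_eq_one (by norm_num)]
  push_cast
  ring

/-- Dividing the doubling inequality by `n` turns it into a decrease of `γ n / n`. -/
theorem div_two_pow_succ_add_le {η : ℝ} {γ : ℕ → ℝ} {n₀ : ℕ} (hn₀ : 1 ≤ n₀)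
    (h : ∀ n, n₀ ≤ n → γ (2 * n) / 2 + n / Real.logb 2 (2 * n) ^ η ≤ γ n)
    {m : ℕ} (hm : n₀ ≤ m) (k : ℕ) :
    γ (2 ^ (k + 1) * m) / (2 ^ (k + 1) * m : ℕ) + 1 / (k + 1 + Real.logb 2 m) ^ η ≤
      γ (2 ^ k * m) / (2 ^ k * m : ℕ) := by
  have hm1 : 1 ≤ m := hn₀.trans hm
  have h1 := h (2 ^ k * m) (hm.trans (Nat.le_mul_of_pos_left _ (by positivity)))
  rw [logb_two_mul_two_pow_mul hm1] at h1
  have hpos : (0 : ℝ) < (2 ^ k * m : ℕ) := by positivity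
  have e : 2 ^ (k + 1) * m = 2 * (2 ^ k * m) := by ring
  rw [e, le_div_iff₀ hpos]
  refine le_trans (le_of_eq ?_) h1
  rw [Nat.cast_mul 2]
  field_simp
  push_cast
  ring

/-- A sequence with increments bounded by `C` grows at most linearly. -/
theorem abs_le_of_abs_sub_pred_le {γ : ℕ → ℝ} {C : ℝ}
    (hC : ∀ n : ℕ, 1 ≤ n → |γ n - γ (n - 1)| ≤ C) (n : ℕ) : |γ n| ≤ |γ 0| + C * n := by
  induction n with
  | zero => simp
  | succ n ih =>
    have h1 := hC (n + 1) (by omega)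
    rw [Nat.add_sub_cancel] at h1
    have h2 := abs_add_le (γ (n + 1) - γ n) (γ n)
    rw [sub_add_cancel] at h2
    push_cast
    linarith

/-- If `γ` is eventually nonnegative, summing the decreases gives the lower bound. -/
theorem lower_bound_of_nonneg {η : ℝ} (hη : 0 < η) {γ : ℕ → ℝ} {n₀ : ℕ} (hn₀ : 1 ≤ n₀)
    (h : ∀ n, n₀ ≤ n → γ (2 * n) / 2 + n / Real.logb 2 (2 * n) ^ η ≤ γ n)
    (hγ : ∀ n, n₀ ≤ n → 0 ≤ γ n) {n : ℕ} (hn : n₀ ≤ n) :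
    1 / 3 ^ η * (2 * n) / Real.logb 2 (2 * n) ^ (η - 1) ≤ γ (2 * n) := by
  have hn1 : 1 ≤ n := hn₀.trans hn
  have hm : n₀ ≤ 2 * n := by omega
  set x := Real.logb 2 (2 * n) with hx
  have hx1 : 1 ≤ x := by
    rw [hx, Real.le_logb_iff_rpow_le (by norm_num) (by positivity), Real.rpow_one]
    have : (1 : ℝ) ≤ n := by exact_mod_cast hn1
    linarith
  set K := ⌈x⌉₊
  have hK1 : x ≤ K := Nat.le_ceil x
  have hK2 : (K : ℝ) < x + 1 := Nat.ceil_lt_add_one (by linarith)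
  have key : ∀ k ≤ K, γ (2 ^ k * (2 * n)) / (2 ^ k * (2 * n) : ℕ) + k * (1 / (3 * x) ^ η) ≤
      γ (2 * n) / (2 * n : ℕ) := by
    intro k
    induction k with
    | zero => simp
    | succ k ih =>
      intro hk
      have h1 := ih (by omega)
      have h2 := div_two_pow_succ_add_le hn₀ h hm k
      rw [Nat.cast_mul 2 n, Nat.cast_two, ← hx] at h2
      have hk' : (k : ℝ) + 1 ≤ K := by exact_mod_cast hk
      have h3 : 1 / (3 * x) ^ η ≤ 1 / (k + 1 + x) ^ η :=
        one_div_le_one_div_of_le (by positivity)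
          (Real.rpow_le_rpow (by positivity) (by linarith) hη.le)
      push_cast at *
      linarith
  have h1 := key K le_rfl
  have h2 : 0 ≤ γ (2 ^ K * (2 * n)) / (2 ^ K * (2 * n) : ℕ) :=
    div_nonneg (hγ _ (hm.trans (Nat.le_mul_of_pos_left _ (by positivity)))) (Nat.cast_nonneg _)
  have h3 : x * (1 / (3 * x) ^ η) ≤ γ (2 * n) / (2 * n : ℕ) :=
    (mul_le_mul_of_nonneg_right hK1 (by positivity)).trans (by linarith)
  rw [le_div_iff₀ (by positivity)] at h3
  refine le_trans (le_of_eq ?_) h3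
  have hx0 : 0 < x := by linarith
  rw [Real.mul_rpow (by norm_num) hx0.le, Real.rpow_sub hx0, Real.rpow_one]
  push_cast
  field_simp

/-- If `γ` is negative at some `m ≥ n₀`, the second alternative holds along `2 ^ k * m`:
the decreases of `γ n / n` are summable there, whereas the harmonic series diverges. -/
theorem frequently_small_of_neg {η : ℝ} {γ : ℕ → ℝ} {C : ℝ}
    (hC : ∀ n : ℕ, 1 ≤ n → |γ n - γ (n - 1)| ≤ C) {n₀ : ℕ} (hn₀ : 1 ≤ n₀)
    (h : ∀ n, n₀ ≤ n → γ (2 * n) / 2 + n / Real.logb 2 (2 * n) ^ η ≤ γ n)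
    {m : ℕ} (hm : n₀ ≤ m) (hneg : γ m < 0) :
    ∃ ε > (0 : ℝ), ∀ N : ℕ, ∃ n, N ≤ n ∧
      γ (2 * n) ≤ -ε * n ∧ γ n - γ (2 * n) / 2 ≤ n / Real.logb 2 (2 * n) := by
  have hm1 : 1 ≤ m := hn₀.trans hm
  have hm0 : (0 : ℝ) < m := by exact_mod_cast hm1
  have hL : 0 ≤ Real.logb 2 m :=
    Real.logb_nonneg (by norm_num) (by exact_mod_cast hm1)
  set g : ℕ → ℝ := fun k => γ (2 ^ k * m) / (2 ^ k * m : ℕ) with hg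
  have hstep : ∀ k, g (k + 1) ≤ g k := fun k => by
    have h1 := div_two_pow_succ_add_le hn₀ h hm k
    have h2 : 0 ≤ 1 / (k + 1 + Real.logb 2 m) ^ η := by positivity
    simp only [hg]
    linarith
  have hanti : Antitone g := antitone_nat_of_succ_le hstep
  have hg0 : g 0 = γ m / m := by simp [hg]
  have hbdd : ∀ k, -(|γ 0| + C) ≤ g k := fun k => by
    have hpos : (1 : ℝ) ≤ (2 ^ k * m : ℕ) := by
      exact_mod_cast Nat.mul_pos (by positivity) hm1
    have h1 := neg_le_of_abs_le (abs_le_of_abs_sub_pred_le hC (2 ^ k * m))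
    simp only [hg]
    rw [le_div_iff₀ (by linarith)]
    nlinarith [abs_nonneg (γ 0)]
  have hsum : Summable fun k => g k - g (k + 1) := by
    refine summable_of_sum_range_le (c := g 0 + (|γ 0| + C))
      (fun k => sub_nonneg.2 (hstep k)) fun k => ?_
    rw [Finset.sum_range_sub']
    linarith [hbdd k]
  refine ⟨-(2 * (γ m / m)), by linarith [div_neg_of_neg_of_pos hneg hm0], fun N => ?_⟩
  by_contra! hcon
  have hlarge : ∀ k, N ≤ k → 1 / (k + 1 + Real.logb 2 m) ≤ g k - g (k + 1) := by
    intro k hk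
    have hpos : (0 : ℝ) < (2 ^ k * m : ℕ) := by positivity
    have hge : N ≤ 2 ^ k * m :=
      hk.trans (Nat.lt_two_pow_self.le.trans (Nat.le_mul_of_pos_right _ hm1))
    have hgk : g (k + 1) = γ (2 * (2 ^ k * m)) / (2 * (2 ^ k * m : ℕ)) := by
      have e : 2 ^ (k + 1) * m = 2 * (2 ^ k * m) := by ring
      simp only [hg]
      rw [e, Nat.cast_mul 2, Nat.cast_two]
    have hle : g (k + 1) ≤ γ m / m := hg0 ▸ hanti (Nat.zero_le _)
    have h1 := hcon _ hge (by
      rw [hgk, div_le_iff₀ (by positivity)] at hle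
      linarith)
    rw [logb_two_mul_two_pow_mul hm1] at h1
    have h2 : g k - g (k + 1) =
        (γ (2 ^ k * m) - γ (2 * (2 ^ k * m)) / 2) / (2 ^ k * m : ℕ) := by
      rw [hgk]
      simp only [hg]
      field_simp
    rw [h2, le_div_iff₀ hpos]
    refine le_trans (le_of_eq ?_) h1.le
    ring
  obtain ⟨M, hM⟩ := exists_nat_ge (1 + Real.logb 2 m)
  refine Real.not_summable_one_div_natCast ((summable_nat_add_iff (N + M)).1 ?_)
  refine Summable.of_nonneg_of_le (fun k => by positivity) (fun k => ?_)
    ((summable_nat_add_iff N).2 hsum)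
  refine le_trans ?_ (hlarge (k + N) (by omega))
  refine one_div_le_one_div_of_le (by positivity) ?_
  push_cast
  linarith

/-- Lemma on sequences: if `1 < η < 2`, the sequence `γ` has bounded increments and satisfies
`γ(n) ≥ γ(2n)/2 + n/(log₂(2n))^η` for all `n ≥ n₀`, then either
`γ(2n) ≥ c·2n/(log₂(2n))^{η-1}` for some `c > 0` and all `n ≥ n₀`, or there is `ε > 0` with
`γ(2n) ≤ -εn` and `γ(n) - γ(2n)/2 ≤ n/log₂(2n)` for infinitely many `n`. -/
theorem seq_dichotomy (η : ℝ) (hη₁ : 1 < η) (hη₂ : η < 2) (γ : ℕ → ℝ)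
    (hC : ∃ C : ℝ, ∀ n : ℕ, 1 ≤ n → |γ n - γ (n - 1)| ≤ C)
    (n₀ : ℕ) (hn₀ : 1 ≤ n₀)
    (h : ∀ n, n₀ ≤ n → γ (2 * n) / 2 + n / Real.logb 2 (2 * n) ^ η ≤ γ n) :
    (∃ c > (0 : ℝ), ∀ n, n₀ ≤ n →
        c * (2 * n) / Real.logb 2 (2 * n) ^ (η - 1) ≤ γ (2 * n)) ∨
    (∃ ε > (0 : ℝ), ∀ N : ℕ, ∃ n, N ≤ n ∧
        γ (2 * n) ≤ -ε * n ∧ γ n - γ (2 * n) / 2 ≤ n / Real.logb 2 (2 * n)) := by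
  obtain ⟨C, hC⟩ := hC
  by_cases hγ : ∀ n, n₀ ≤ n → 0 ≤ γ n
  · exact Or.inl ⟨1 / 3 ^ η, by positivity, fun n hn =>
      lower_bound_of_nonneg (by linarith) hn₀ h hγ hn⟩
  · push Not at hγ
    obtain ⟨m, hm, hneg⟩ := hγ
    exact Or.inr (frequently_small_of_neg hC hn₀ h hm hneg)
end

section
/- Let p be the unique root in (0,1) of p³ = (1−p)², and define L_k = k/(2−p) − (1−(p−1)^k)(p−1)²/(2−p)² for k ≥ 1. For a positive integer n with 2^{ℓ−1} < n ≤ 2^ℓ, let A_k(n) be the number of odd integers in the interval (n/2^k, n/2^{k−1}], and set E(n) = Σ_{k=1}^{ℓ+1} A_k(n)·L_k. Then there exists a constant C > 0 such that for all n ≥ 2, |E(2n)/2 − E(n)| ≤ C·(log₂ n)². (Here E(n) is the expectation of the number of 0 digits among the first n coordinates under the measure Prob_μ.) -/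
noncomputable section

/-- `L_k = k/(2-p) - (1-(p-1)^k)(p-1)²/(2-p)²`. -/
def Lk (p : ℝ) (k : ℕ) : ℝ :=
  k / (2 - p) - (1 - (p - 1) ^ k) * (p - 1) ^ 2 / (2 - p) ^ 2

/-- `A_k(n)`: the number of odd integers `i` with `n/2^k < i ≤ n/2^{k-1}` (equivalently,
`n < i·2^k` and `i·2^{k-1} ≤ n`). -/
def Acount (n k : ℕ) : ℕ :=
  ((Finset.range (n + 1)).filter fun i => Odd i ∧ n < i * 2 ^ k ∧ i * 2 ^ (k - 1) ≤ n).card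

/-- `E(n) = ∑_{k=1}^{ℓ+1} A_k(n)·L_k`, where `ℓ = Nat.clog 2 n` is the integer with
`2^{ℓ-1} < n ≤ 2^ℓ`; this is the expectation of the number of `0` digits among the first `n`
coordinates under `Prob_μ`. -/
def Efun (p : ℝ) (n : ℕ) : ℝ :=
  ∑ k ∈ Finset.Icc 1 (Nat.clog 2 n + 1), (Acount n k : ℝ) * Lk p k

theorem card_filter_odd_range (m : ℕ) : ((Finset.range m).filter fun i => Odd i).card = m / 2 := by
  induction m with
  | zero => simp
  | succ m ih =>
    rw [Finset.range_add_one, Finset.filter_insert]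
    split_ifs with h
    · rw [Finset.card_insert_of_notMem (by simp), ih]
      obtain ⟨j, rfl⟩ := h
      omega
    · rw [ih]
      obtain ⟨j, rfl⟩ := Nat.not_odd_iff_even.mp h
      omega

theorem card_filter_odd_mul_le (n : ℕ) {d : ℕ} (hd : 0 < d) :
    ((Finset.range (n + 1)).filter fun i => Odd i ∧ i * d ≤ n).card = (n / d + 1) / 2 := by
  rw [← card_filter_odd_range]
  congr 1
  ext i
  simp only [Finset.mem_filter, Finset.mem_range, Nat.lt_succ_iff, Nat.le_div_iff_mul_le hd]
  constructor
  · rintro ⟨-, h, h'⟩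
    exact ⟨h', h⟩
  · rintro ⟨h, h'⟩
    exact ⟨(Nat.le_mul_of_pos_right i hd).trans h, h', h⟩

/-- The odd integers up to `n / 2 ^ j` split into those up to `n / 2 ^ (j + 1)` and those counted
by `Acount n (j + 1)`. -/
theorem Acount_succ_add (n j : ℕ) :
    Acount n (j + 1) + (n / 2 ^ (j + 1) + 1) / 2 = (n / 2 ^ j + 1) / 2 := by
  rw [← card_filter_odd_mul_le n (pow_pos two_pos (j + 1)),
    ← card_filter_odd_mul_le n (pow_pos two_pos j), Acount, ← Finset.card_union_of_disjoint]
  · congr 1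
    ext i
    simp only [Finset.mem_union, Finset.mem_filter, Finset.mem_range, Nat.add_sub_cancel]
    have h : i * 2 ^ (j + 1) = 2 * (i * 2 ^ j) := by ring
    rw [h]
    grind
  · rw [Finset.disjoint_filter]
    rintro i - ⟨-, h, -⟩ ⟨-, h'⟩
    omega

theorem Acount_clog_add_two (n : ℕ) : Acount n (Nat.clog 2 n + 2) = 0 := by
  have h := Acount_succ_add n (Nat.clog 2 n + 1)
  have hn : n ≤ 2 ^ Nat.clog 2 n := Nat.le_pow_clog one_lt_two n
  have hlt : n < 2 ^ (Nat.clog 2 n + 1) := hn.trans_lt (Nat.pow_lt_pow_right one_lt_two (by omega))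
  simp only [Nat.div_eq_of_lt hlt] at h
  exact (Nat.add_eq_zero_iff.mp h).1

theorem abs_Acount_two_mul_div_two_sub_le (n k : ℕ) (hk : 1 ≤ k) :
    |(Acount (2 * n) k : ℝ) / 2 - Acount n k| ≤ 2 := by
  obtain ⟨j, rfl⟩ := Nat.exists_eq_add_of_le' hk
  have h₁ := Acount_succ_add n j
  have h₂ := Acount_succ_add (2 * n) j
  have hy : 2 * n / 2 ^ (j + 1) = n / 2 ^ j := by
    rw [pow_succ', Nat.mul_div_mul_left _ _ two_pos]
  have hz : n / 2 ^ (j + 1) = n / 2 ^ j / 2 := by rw [pow_succ, Nat.div_div_eq_div_mul]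
  have hx : 2 * n / 2 ^ j / 2 = n / 2 ^ j := by rw [Nat.div_div_eq_div_mul, ← pow_succ, hy]
  rw [hz] at h₁
  rw [hy] at h₂
  have hu : Acount (2 * n) (j + 1) ≤ 2 * Acount n (j + 1) + 4 := by omega
  have hl : 2 * Acount n (j + 1) ≤ Acount (2 * n) (j + 1) + 4 := by omega
  have hu' : (Acount (2 * n) (j + 1) : ℝ) ≤ 2 * Acount n (j + 1) + 4 := by exact_mod_cast hu
  have hl' : 2 * (Acount n (j + 1) : ℝ) ≤ Acount (2 * n) (j + 1) + 4 := by exact_mod_cast hl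
  rw [abs_le]
  constructor <;> linarith

theorem abs_Lk_le {p : ℝ} (hp : p ∈ Set.Ioo (0 : ℝ) 1) (k : ℕ) : |Lk p k| ≤ k + 2 := by
  obtain ⟨h0, h1⟩ := hp
  have hk : (k : ℝ) / (2 - p) ≤ k := div_le_self (by positivity) (by linarith)
  have hk0 : 0 ≤ (k : ℝ) / (2 - p) := div_nonneg (by positivity) (by linarith)
  have hpow : |(p - 1) ^ k| ≤ 1 := by
    rw [abs_pow]
    exact pow_le_one₀ (abs_nonneg _) (abs_le.mpr ⟨by linarith, by linarith⟩)
  have hq : (p - 1) ^ 2 / (2 - p) ^ 2 ≤ 1 := by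
    rw [div_le_one (pow_pos (by linarith) 2)]
    nlinarith
  have hq0 : 0 ≤ (p - 1) ^ 2 / (2 - p) ^ 2 := by positivity
  obtain ⟨hl, hu⟩ := abs_le.mp hpow
  rw [Lk, mul_div_assoc, abs_le]
  constructor <;> nlinarith

theorem clog_two_le_logb_add_one (n : ℕ) :
    (Nat.clog 2 n : ℝ) ≤ Real.logb 2 n + 1 := by
  have h : Nat.clog 2 n ≤ Nat.log 2 n + 1 :=
    Nat.clog_le_of_le_pow (Nat.lt_pow_succ_log_self one_lt_two n).le
  have h' : (Nat.clog 2 n : ℝ) ≤ Nat.log 2 n + 1 := by exact_mod_cast h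
  have hlog : (Nat.log 2 n : ℝ) ≤ Real.logb 2 n := by exact_mod_cast Real.natLog_le_logb n 2
  linarith

theorem Efun_two_mul_div_two_sub (p : ℝ) {n : ℕ} (hn : 2 ≤ n) :
    Efun p (2 * n) / 2 - Efun p n =
      ∑ k ∈ Finset.Icc 1 (Nat.clog 2 n + 2),
        ((Acount (2 * n) k : ℝ) / 2 - Acount n k) * Lk p k := by
  have hclog : Nat.clog 2 (2 * n) = Nat.clog 2 n + 1 := by
    rw [Nat.clog_of_two_le one_lt_two (by omega)]
    congr 2
    omega
  have hE : Efun p n = ∑ k ∈ Finset.Icc 1 (Nat.clog 2 n + 2), (Acount n k : ℝ) * Lk p k := by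
    rw [Finset.sum_Icc_succ_top (by omega), Acount_clog_add_two, Efun]
    simp
  rw [hE, Efun, hclog, Finset.sum_div, ← Finset.sum_sub_distrib]
  exact Finset.sum_congr rfl fun k _ => by ring

/-- There is `C > 0` with `|E(2n)/2 - E(n)| ≤ C (log₂ n)²` for all `n ≥ 2`. -/
theorem Efun_doubling (p : ℝ) (hp : p ∈ Set.Ioo (0 : ℝ) 1) (hpe : p ^ 3 = (1 - p) ^ 2) :
    ∃ C > (0 : ℝ), ∀ n : ℕ, 2 ≤ n →
      |Efun p (2 * n) / 2 - Efun p n| ≤ C * Real.logb 2 n ^ 2 := by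
  refine ⟨48, by norm_num, fun n hn => ?_⟩
  have hL : 1 ≤ Real.logb 2 n := by
    rw [Real.le_logb_iff_rpow_le one_lt_two (by positivity), Real.rpow_one]
    exact_mod_cast hn
  have hc := clog_two_le_logb_add_one n
  rw [Efun_two_mul_div_two_sub p hn]
  calc |∑ k ∈ Finset.Icc 1 (Nat.clog 2 n + 2),
          ((Acount (2 * n) k : ℝ) / 2 - Acount n k) * Lk p k|
      ≤ ∑ k ∈ Finset.Icc 1 (Nat.clog 2 n + 2),
          |((Acount (2 * n) k : ℝ) / 2 - Acount n k) * Lk p k| := Finset.abs_sum_le_sum_abs _ _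
    _ ≤ ∑ _k ∈ Finset.Icc 1 (Nat.clog 2 n + 2), 2 * ((Nat.clog 2 n : ℝ) + 4) := by
        refine Finset.sum_le_sum fun k hk => ?_
        obtain ⟨hk1, hk2⟩ := Finset.mem_Icc.mp hk
        have hk' : (k : ℝ) ≤ Nat.clog 2 n + 2 := by exact_mod_cast hk2
        rw [abs_mul]
        exact mul_le_mul (abs_Acount_two_mul_div_two_sub_le n k hk1)
          ((abs_Lk_le hp k).trans (by linarith)) (abs_nonneg _) zero_le_two
    _ = ((Nat.clog 2 n : ℝ) + 2) * (2 * ((Nat.clog 2 n : ℝ) + 4)) := by simp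
    _ ≤ (4 * Real.logb 2 n) * (2 * (6 * Real.logb 2 n)) := by
        gcongr <;> linarith
    _ = 48 * Real.logb 2 n ^ 2 := by ring

end
end

section
/- There exist constants c₂, c₃ > 0 such that for all real t > 0 and all positive integers n, Prob_μ( x : |N₀(x₁^{2n}) − E[N₀(x₁^{2n})]| ≥ t·n ) ≤ c₂·exp(−c₃·t²·n), where N₀(x₁^{m}) is the number of 0s among the first m coordinates of x and E denotes expectation with respect to Prob_μ. -/
open MeasureTheory Filter Set
open scoped ENNReal Classical

noncomputable section

/-- The multiplicative golden mean shift `X_G = {x : x_k · x_{2k} = 0 for all k ≥ 1}`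
(in 0-based coordinates: the paper's position `k` is index `k-1`). -/
def XG : Set Sigma2 := {x : Sigma2 | ∀ k : ℕ, x k = true → x (2 * k + 1) = false}

/-- The restriction `u|_{J(i)}` of a sequence to the geometric progression
`J(i) = {i·2^r : r ≥ 0}` (paper positions `i·2^r` are 0-based indices `i·2^r - 1`). -/
def restrictJ (x : Sigma2) (i : ℕ) : ℕ → Bool := fun r => x (i * 2 ^ r - 1)

/-- The value `Prob_μ[x₁…xₙ] = ∏_{i ≤ n, i odd} μ(p)[u|_{J(i)}]`, where the word `u|_{J(i)}`
has length `#(J(i) ∩ [1,n]) = log₂⌊n/i⌋ + 1`. -/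
def ProbMuVal (p : ℝ) (x : Sigma2) (n : ℕ) : ℝ :=
  ∏ i ∈ (Finset.Icc 1 n).filter (fun i => Odd i),
    markovCylProb p (restrictJ x i) (Nat.log 2 (n / i) + 1)

/-- The number of `0` symbols among the first `m` coordinates (the paper's `N₀(x₁^m)`). -/
def N0count (x : Sigma2) (m : ℕ) : ℕ := ((Finset.range m).filter fun j => x j = false).card

section FiniteProductLaw

open ProbabilityTheory

/-- Random variables with values in finite spaces whose joint mass function is a product of
(not necessarily normalized) functions of the single values are independent. -/
lemma iIndepFun_of_measure_eq_prod {Ω ι : Type*} [MeasurableSpace Ω] [Fintype ι]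
    {W : ι → Type*} [∀ i, Fintype (W i)] [∀ i, MeasurableSpace (W i)]
    [∀ i, MeasurableSingletonClass (W i)] {μ : Measure Ω} [IsProbabilityMeasure μ]
    {X : ∀ i, Ω → W i} (hX : ∀ i, Measurable (X i)) (f : ∀ i, W i → ℝ≥0∞)
    (hf : ∀ i w, f i w ≠ ∞)
    (h : ∀ w : ∀ i, W i, μ {ω | ∀ i, X i ω = w i} = ∏ i, f i (w i)) :
    iIndepFun X μ := by
  have hXpi : Measurable fun ω i => X i ω := measurable_pi_lambda _ hX
  have hmass : ∀ w : ∀ i, W i, μ.map (fun ω i => X i ω) {w} = ∏ i, f i (w i) := by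
    intro w
    rw [Measure.map_apply hXpi (measurableSet_singleton w), ← h w]
    congr 1
    ext ω
    simp [funext_iff]
  have hZ : ∏ i, ∑ w, f i w = 1 := by
    rw [Finset.prod_univ_sum]
    have := Measure.isProbabilityMeasure_map (μ := μ) hXpi.aemeasurable
    rw [← measure_univ (μ := μ.map (fun ω i => X i ω)), ← Finset.coe_univ,
      ← sum_measure_singleton, Fintype.piFinset_univ]
    exact Finset.sum_congr rfl fun w _ => (hmass w).symm
  have hZ0 : ∀ i, ∑' w, f i w ≠ 0 := by
    intro i hi
    rw [tsum_fintype] at hi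
    rw [Finset.prod_eq_zero (Finset.mem_univ i) hi] at hZ
    exact zero_ne_one hZ
  have hZtop : ∀ i, ∑' w, f i w ≠ ∞ := by
    intro i
    rw [tsum_fintype]
    exact ENNReal.sum_ne_top.2 fun w _ => hf i w
  let ν : ∀ i, Measure (W i) := fun i => (PMF.normalize (f i) (hZ0 i) (hZtop i)).toMeasure
  have hjoint : μ.map (fun ω i => X i ω) = Measure.pi ν := by
    refine Measure.ext_of_singleton fun w => ?_
    rw [hmass, Measure.pi_singleton]
    simp only [ν, PMF.toMeasure_apply_singleton _ _ (measurableSet_singleton _),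
      PMF.normalize_apply, Finset.prod_mul_distrib]
    rw [← ENNReal.prod_inv_distrib]
    · simp [tsum_fintype, hZ]
    · exact fun i _ j _ _ => Or.inl (hZ0 i)
  have hmarg : ∀ i, μ.map (X i) = ν i := by
    intro i
    rw [← (measurePreserving_eval ν i).map_eq, ← hjoint,
      Measure.map_map (measurable_pi_apply i) hXpi]
    rfl
  rw [iIndepFun_iff_map_fun_eq_pi_map fun i => (hX i).aemeasurable, hjoint]
  simp only [hmarg]

end FiniteProductLaw

section Estimates

lemma sum_inv_sqrt_le (N : ℕ) : ∑ i ∈ Finset.Icc 1 N, 1 / √(i : ℝ) ≤ 2 * √(N : ℝ) := by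
  induction N with
  | zero => simp
  | succ k ih =>
    rw [Finset.sum_Icc_succ_top (by omega)]
    have h1 : 0 < √((k + 1 : ℕ) : ℝ) := Real.sqrt_pos.2 (by positivity)
    have h2 : √((k + 1 : ℕ) : ℝ) ^ 2 = k + 1 := by
      rw [Real.sq_sqrt (by positivity)]; push_cast; ring
    have h3 : √(k : ℝ) ^ 2 = k := Real.sq_sqrt (by positivity)
    have h4 : 1 / √((k + 1 : ℕ) : ℝ) ≤ 2 * (√((k + 1 : ℕ) : ℝ) - √(k : ℝ)) := by
      rw [div_le_iff₀ h1]
      nlinarith [sq_nonneg (√((k + 1 : ℕ) : ℝ) - √(k : ℝ))]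
    linarith

lemma succ_pow_four_le (l : ℕ) : (l + 1) ^ 4 ≤ 64 * 2 ^ l := by
  rcases Nat.lt_or_ge l 5 with hl | hl
  · interval_cases l <;> norm_num
  · induction l, hl using Nat.le_induction with
    | base => norm_num
    | succ k hk ih =>
      calc (k + 1 + 1) ^ 4 ≤ 2 * (k + 1) ^ 4 := by
            obtain ⟨m, rfl⟩ := Nat.exists_eq_add_of_le hk
            ring_nf
            have : m ^ 2 ≤ m ^ 3 + m := by nlinarith [sq_nonneg ((m : ℤ) - 1), Nat.zero_le m]
            nlinarith
        _ ≤ 64 * 2 ^ (k + 1) := by rw [pow_succ 2 k]; omega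

lemma log_succ_sq_le {q : ℕ} (hq : q ≠ 0) : ((Nat.log 2 q + 1 : ℕ) : ℝ) ^ 2 ≤ 8 * √(q : ℝ) := by
  have h1 : (Nat.log 2 q + 1) ^ 4 ≤ 64 * q :=
    (succ_pow_four_le _).trans (Nat.mul_le_mul_left _ (Nat.pow_log_le_self 2 hq))
  refine (pow_le_pow_iff_left₀ (by positivity) (by positivity) two_ne_zero).1 ?_
  rw [mul_pow, Real.sq_sqrt (by positivity), ← pow_mul]
  norm_num
  exact_mod_cast h1

end Estimates

section Blocks

/-- The odd indices `i ≤ N`, which label the blocks `J(i) ∩ [1,N]`. -/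
def oddIdx (N : ℕ) : Finset ℕ := (Finset.Icc 1 N).filter fun i => Odd i

/-- The number of elements of `J(i) ∩ [1,N]`. -/
def blockLen (N i : ℕ) : ℕ := Nat.log 2 (N / i) + 1

lemma lt_blockLen_iff {N i r : ℕ} (hi : i ∈ oddIdx N) : r < blockLen N i ↔ i * 2 ^ r ≤ N := by
  obtain ⟨h1, hN⟩ := Finset.mem_Icc.1 (Finset.mem_filter.1 hi).1
  rw [blockLen, Nat.lt_succ_iff, Nat.le_log_iff_pow_le one_lt_two (Nat.div_pos hN h1).ne',
    Nat.le_div_iff_mul_le h1, mul_comm]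

lemma sum_blockLen_sq_le (N : ℕ) :
    ∑ i ∈ oddIdx N, (blockLen N i : ℝ) ^ 2 ≤ 16 * N := by
  calc ∑ i ∈ oddIdx N, (blockLen N i : ℝ) ^ 2
      ≤ ∑ i ∈ Finset.Icc 1 N, (blockLen N i : ℝ) ^ 2 :=
        Finset.sum_le_sum_of_subset_of_nonneg (Finset.filter_subset _ _) fun _ _ _ => sq_nonneg _
    _ ≤ ∑ i ∈ Finset.Icc 1 N, 8 * √(N : ℝ) * (1 / √(i : ℝ)) := by
        refine Finset.sum_le_sum fun i hi => ?_
        obtain ⟨h1, hN⟩ := Finset.mem_Icc.1 hi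
        refine (log_succ_sq_le (Nat.div_pos hN h1).ne').trans ?_
        rw [mul_assoc, mul_one_div, ← Real.sqrt_div (by positivity)]
        gcongr
        exact Nat.cast_div_le
    _ ≤ 8 * √(N : ℝ) * (2 * √(N : ℝ)) := by
        rw [← Finset.mul_sum]
        gcongr
        exact sum_inv_sqrt_le N
    _ = 16 * N := by
        linear_combination 16 * Real.mul_self_sqrt (Nat.cast_nonneg (α := ℝ) N)

lemma mul_two_pow_inj {i j r s : ℕ} (hi : Odd i) (hj : Odd j) (h : i * 2 ^ r = j * 2 ^ s) :
    i = j ∧ r = s := by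
  wlog hrs : r ≤ s generalizing i j r s
  · exact (this hj hi h.symm (le_of_not_ge hrs)).imp Eq.symm Eq.symm
  obtain ⟨d, rfl⟩ := Nat.exists_eq_add_of_le hrs
  have h' : i = j * 2 ^ d := by
    refine Nat.eq_of_mul_eq_mul_right (Nat.two_pow_pos r) ?_
    rw [h, pow_add]
    ring
  cases d with
  | zero => simpa using h'
  | succ d =>
    rw [h', pow_succ, ← mul_assoc] at hi
    exact absurd hi (Nat.not_odd_iff_even.2 (even_two.mul_left _))

/-- The coordinates below `N` are the disjoint union of the blocks `J(i)`, `i ≤ N` odd. -/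
def blockEquiv (N : ℕ) : (Σ i : oddIdx N, Fin (blockLen N i)) ≃ Fin N :=
  Equiv.ofBijective
    (fun s => ⟨(s.1 : ℕ) * 2 ^ (s.2 : ℕ) - 1, by
      have h1 := (lt_blockLen_iff s.1.2).1 s.2.2
      have h2 := (Finset.mem_Icc.1 (Finset.mem_filter.1 s.1.2).1).1
      have h3 : 0 < (s.1 : ℕ) * 2 ^ (s.2 : ℕ) := Nat.mul_pos h2 (Nat.two_pow_pos _)
      omega⟩) <| by
    constructor
    · rintro ⟨⟨i, hi⟩, r⟩ ⟨⟨j, hj⟩, s⟩ h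
      obtain ⟨hi1, hio⟩ := Finset.mem_filter.1 hi
      obtain ⟨hj1, hjo⟩ := Finset.mem_filter.1 hj
      have hi2 : 0 < i * 2 ^ (r : ℕ) := Nat.mul_pos (Finset.mem_Icc.1 hi1).1 (Nat.two_pow_pos _)
      have hj2 : 0 < j * 2 ^ (s : ℕ) := Nat.mul_pos (Finset.mem_Icc.1 hj1).1 (Nat.two_pow_pos _)
      have h' : i * 2 ^ (r : ℕ) - 1 = j * 2 ^ (s : ℕ) - 1 := congrArg Fin.val h
      obtain ⟨rfl, hrs⟩ := mul_two_pow_inj hio hjo (by omega : i * 2 ^ (r : ℕ) = j * 2 ^ (s : ℕ))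
      rw [Fin.ext hrs]
    · rintro ⟨k, hk⟩
      obtain ⟨r, i, hio, hri⟩ := Nat.exists_eq_two_pow_mul_odd (Nat.succ_ne_zero k)
      have hri' : i * 2 ^ r = k + 1 := by rw [mul_comm]; exact hri.symm
      have hi : i ∈ oddIdx N := by
        refine Finset.mem_filter.2 ⟨Finset.mem_Icc.2 ⟨hio.pos, ?_⟩, hio⟩
        have := Nat.le_mul_of_pos_right i (Nat.two_pow_pos r)
        omega
      refine ⟨⟨⟨i, hi⟩, ⟨r, (lt_blockLen_iff hi).2 (by omega)⟩⟩, Fin.ext ?_⟩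
      change i * 2 ^ r - 1 = k
      omega

/-- The coordinate of `x` with index `j`. -/
def coord (x : Sigma2) (j : ℕ) : Bool := x j

/-- The word `x|_{J(i)}` inside the first `N` coordinates. -/
def block (N : ℕ) (i : oddIdx N) (x : Sigma2) : Fin (blockLen N i) → Bool :=
  fun r => restrictJ x i r

lemma block_apply (N : ℕ) (i : oddIdx N) (x : Sigma2) (r : Fin (blockLen N i)) :
    block N i x r = coord x (blockEquiv N ⟨i, r⟩) := rfl

lemma exists_block_eq (N : ℕ) (w : ∀ i : oddIdx N, Fin (blockLen N i) → Bool) :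
    ∃ x : Sigma2, ∀ i, block N i x = w i := by
  refine ⟨fun j => if h : j < N then
    w ((blockEquiv N).symm ⟨j, h⟩).1 ((blockEquiv N).symm ⟨j, h⟩).2 else false, fun i => ?_⟩
  ext1 r
  refine (dif_pos (blockEquiv N ⟨i, r⟩).2).trans ?_
  change (fun s : Σ i : oddIdx N, Fin (blockLen N i) => w s.1 s.2)
    ((blockEquiv N).symm (blockEquiv N ⟨i, r⟩)) = w i r
  rw [Equiv.symm_apply_apply]

lemma block_eq_iff_mem_Cyl (N : ℕ) (x y : Sigma2) :
    (∀ i, block N i y = block N i x) ↔ y ∈ Cyl x N := by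
  change _ ↔ ∀ j < N, coord y j = coord x j
  constructor
  · intro h j hj
    simpa [block_apply] using congrFun (h ((blockEquiv N).symm ⟨j, hj⟩).1)
      ((blockEquiv N).symm ⟨j, hj⟩).2
  · intro h i
    ext1 r
    exact h _ (blockEquiv N ⟨i, r⟩).2

lemma measurable_coord (j : ℕ) : Measurable fun x : Sigma2 => coord x j := by
  have h : Continuous fun x : Sigma2 => coord x j := continuous_apply (A := fun _ : ℕ => Bool) j
  exact h.measurable

lemma measurable_block (N : ℕ) (i : oddIdx N) : Measurable (block N i) :=
  measurable_pi_lambda _ fun _ => measurable_coord _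

/-- The number of zeros in a finite word. -/
def zeros {k : ℕ} (w : Fin k → Bool) : ℝ := ∑ r, if w r = false then 1 else 0

lemma zeros_mem_Icc {k : ℕ} (w : Fin k → Bool) : zeros w ∈ Set.Icc (0 : ℝ) k := by
  constructor
  · exact Finset.sum_nonneg fun r _ => by split_ifs <;> norm_num
  · calc zeros w ≤ ∑ _r : Fin k, (1 : ℝ) :=
        Finset.sum_le_sum fun r _ => by split_ifs <;> norm_num
      _ = k := by simp

lemma N0count_eq_sum_zeros (N : ℕ) (x : Sigma2) :
    (N0count x N : ℝ) = ∑ i : oddIdx N, zeros (block N i x) := by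
  have h : ∀ i, zeros (block N i x) =
      ∑ r, if coord x (blockEquiv N ⟨i, r⟩) = false then (1 : ℝ) else 0 := fun _ => rfl
  simp only [h]
  rw [← Fintype.sum_sigma fun s => if coord x (blockEquiv N s) = false then (1 : ℝ) else 0,
    (blockEquiv N).sum_comp fun j => if coord x j = false then (1 : ℝ) else 0,
    Fin.sum_univ_eq_sum_range fun j => if coord x j = false then (1 : ℝ) else 0,
    Finset.sum_boole, N0count]
  congr!

end Blocks

section MarkovWeights

lemma markovCylProb_nonneg {r : ℝ} (hr : r ∈ Set.Ioo (0 : ℝ) 1) (w : ℕ → Bool) (k : ℕ) :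
    0 ≤ markovCylProb r w k := by
  unfold markovCylProb
  split_ifs
  · exact mul_nonneg (pow_nonneg (by linarith [hr.2]) _) (zpow_nonneg hr.1.le _)
  · exact le_rfl

lemma markovCylProb_congr (r : ℝ) {v w : ℕ → Bool} {k : ℕ} (h : ∀ j < k, v j = w j) :
    markovCylProb r v k = markovCylProb r w k := by
  have h0 : Ncount0 v k = Ncount0 w k :=
    congrArg Finset.card <| Finset.filter_congr fun j hj => by rw [h j (Finset.mem_range.1 hj)]
  have h1 : ∀ l ≤ k, Ncount1 v l = Ncount1 w l := fun l hl =>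
    congrArg Finset.card <| Finset.filter_congr fun j hj => by
      rw [h j ((Finset.mem_range.1 hj).trans_le hl)]
  have hA : Admissible v k ↔ Admissible w k :=
    forall₂_congr fun j hj => by rw [h j (by omega), h (j + 1) hj]
  simp only [markovCylProb, hA, h0, h1 k le_rfl, h1 (k - 1) (Nat.sub_le _ _)]

/-- The weight `μ(r)[w]` of a finite word `w`. -/
def wordWeight (r : ℝ) {k : ℕ} (w : Fin k → Bool) : ℝ :=
  markovCylProb r (fun j => if h : j < k then w ⟨j, h⟩ else false) k

lemma wordWeight_nonneg {r : ℝ} (hr : r ∈ Set.Ioo (0 : ℝ) 1) {k : ℕ} (w : Fin k → Bool) :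
    0 ≤ wordWeight r w :=
  markovCylProb_nonneg hr _ _

lemma ProbMuVal_eq_prod_wordWeight (p : ℝ) (x : Sigma2) (N : ℕ) :
    ProbMuVal p x N = ∏ i : oddIdx N, wordWeight p (block N i x) := by
  rw [ProbMuVal]
  change ∏ i ∈ oddIdx N, _ = _
  rw [← Finset.prod_coe_sort]
  refine Finset.prod_congr rfl fun i _ => markovCylProb_congr p fun j hj => ?_
  rw [dif_pos (show j < blockLen N i from hj)]
  rfl

end MarkovWeights

section Concentration

open ProbabilityTheory
open scoped NNReal

variable {p : ℝ} {P : Measure Sigma2} [IsProbabilityMeasure P]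

lemma iIndepFun_block (hp : p ∈ Set.Ioo (0 : ℝ) 1)
    (hP : ∀ (x : Sigma2) (n : ℕ), 1 ≤ n → P (Cyl x n) = ENNReal.ofReal (ProbMuVal p x n))
    {N : ℕ} (hN : 1 ≤ N) : iIndepFun (block N) P := by
  refine iIndepFun_of_measure_eq_prod (measurable_block N)
    (fun i w => ENNReal.ofReal (wordWeight p w)) (fun _ _ => ENNReal.ofReal_ne_top) fun w => ?_
  obtain ⟨x, hx⟩ := exists_block_eq N w
  simp only [← hx, block_eq_iff_mem_Cyl, Set.ofPred_mem_eq]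
  rw [hP x N hN, ProbMuVal_eq_prod_wordWeight,
    ENNReal.ofReal_prod_of_nonneg fun i _ => wordWeight_nonneg hp (block N i x)]

/-- The number of zeros in the block `J(i) ∩ [1,N]`, centred. -/
def centredZeros (P : Measure Sigma2) (N : ℕ) (i : oddIdx N) (x : Sigma2) : ℝ :=
  zeros (block N i x) - ∫ y, zeros (block N i y) ∂P

lemma measurable_zeros_block (N : ℕ) (i : oddIdx N) :
    Measurable fun x => zeros (block N i x) :=
  (measurable_of_finite zeros).comp (measurable_block N i)

lemma hasSubgaussianMGF_centredZeros (N : ℕ) (i : oddIdx N) :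
    HasSubgaussianMGF (centredZeros P N i) (((blockLen N i : ℝ≥0) / 2) ^ 2) P := by
  have h := hasSubgaussianMGF_of_mem_Icc (measurable_zeros_block N i).aemeasurable
    (Filter.Eventually.of_forall fun x => zeros_mem_Icc (block N i x)) (μ := P)
  have hnorm : ‖(blockLen N i : ℝ) - 0‖₊ = blockLen N i := by simp
  rwa [hnorm] at h

lemma sum_centredZeros (N : ℕ) (x : Sigma2) :
    ∑ i, centredZeros P N i x = (N0count x N : ℝ) - ∫ y, (N0count y N : ℝ) ∂P := by
  simp only [centredZeros, N0count_eq_sum_zeros, Finset.sum_sub_distrib]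
  rw [integral_finsetSum]
  exact fun i _ => Integrable.of_mem_Icc 0 _ (measurable_zeros_block N i).aemeasurable
    (Filter.Eventually.of_forall fun x => zeros_mem_Icc (block N i x))

lemma sum_proxy_le (N : ℕ) :
    ((∑ i : oddIdx N, ((blockLen N i : ℝ≥0) / 2) ^ 2 : ℝ≥0) : ℝ) ≤ 4 * N := by
  push_cast
  rw [Finset.sum_coe_sort (oddIdx N) fun i => ((blockLen N i : ℝ) / 2) ^ 2]
  simp only [div_pow]
  rw [← Finset.sum_div]
  linarith [sum_blockLen_sq_le N]

lemma exp_neg_sq_div_le {c t N : ℝ} (hc : 0 < c) (h : c ≤ 4 * (2 * N)) :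
    Real.exp (-(t * N) ^ 2 / (2 * c)) ≤ Real.exp (-(1 / 16) * t ^ 2 * N) := by
  have hN : 0 < N := by linarith
  refine Real.exp_le_exp.2 ?_
  rw [div_le_iff₀ (by positivity)]
  have : t ^ 2 * N * c ≤ t ^ 2 * N * (4 * (2 * N)) := by gcongr
  nlinarith

end Concentration

/-- Lemma 4.2 (large deviations): there are `c₂, c₃ > 0` such that for all `t > 0` and `n ≥ 1`,
`Prob_μ(|N₀(x₁^{2n}) - E[N₀(x₁^{2n})]| ≥ t·n) ≤ c₂·exp(-c₃·t²·n)`, where `Prob_μ` is the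
Borel probability measure determined on cylinders by `ProbMuVal` (with `p` the root in
`(0,1)` of `p³ = (1-p)²`). -/
theorem probMu_large_deviation (p : ℝ) (hp : p ∈ Set.Ioo (0 : ℝ) 1)
    (hpe : p ^ 3 = (1 - p) ^ 2)
    (P : Measure Sigma2) (hPprob : IsProbabilityMeasure P)
    (hP : ∀ (x : Sigma2) (n : ℕ), 1 ≤ n → P (Cyl x n) = ENNReal.ofReal (ProbMuVal p x n)) :
    ∃ c₂ > (0 : ℝ), ∃ c₃ > (0 : ℝ), ∀ t : ℝ, 0 < t → ∀ n : ℕ, 1 ≤ n →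
      P {x : Sigma2 |
          t * n ≤ |(N0count x (2 * n) : ℝ) - ∫ y, (N0count y (2 * n) : ℝ) ∂P|}
        ≤ ENNReal.ofReal (c₂ * Real.exp (-c₃ * t ^ 2 * n)) := by
  refine ⟨2, two_pos, 1 / 16, by norm_num, fun t ht n hn => ?_⟩
  have hN : 1 ≤ 2 * n := by omega
  have hε : 0 ≤ t * n := by positivity
  set Y := centredZeros P (2 * n)
  have hind : ProbabilityTheory.iIndepFun Y P :=
    (iIndepFun_block hp hP hN).comp
      (fun i w => zeros w - ∫ y, zeros (block (2 * n) i y) ∂P) fun i => measurable_of_finite _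
  have hind' : ProbabilityTheory.iIndepFun (fun i => -Y i) P :=
    hind.comp (fun _ y => -y) fun _ => measurable_neg
  have hsub := fun i => hasSubgaussianMGF_centredZeros (P := P) (2 * n) i
  have hc : (0 : ℝ) < (∑ i : oddIdx (2 * n), ((blockLen (2 * n) i : NNReal) / 2) ^ 2 : NNReal) := by
    have h1 : 1 ∈ oddIdx (2 * n) :=
      Finset.mem_filter.2 ⟨Finset.mem_Icc.2 ⟨le_rfl, hN⟩, odd_one⟩
    refine NNReal.coe_pos.2 (Finset.sum_pos (fun i _ => ?_) ⟨⟨1, h1⟩, Finset.mem_univ _⟩)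
    have : 0 < blockLen (2 * n) i := Nat.succ_pos _
    positivity
  have hcle := sum_proxy_le (2 * n)
  rw [Nat.cast_mul, Nat.cast_ofNat] at hcle
  have hexp := exp_neg_sq_div_le (t := t) hc hcle
  have hup := (ProbabilityTheory.HasSubgaussianMGF.measure_sum_ge_le_of_iIndepFun hind
    (s := Finset.univ) (fun i _ => hsub i) hε).trans hexp
  have hdown := (ProbabilityTheory.HasSubgaussianMGF.measure_sum_ge_le_of_iIndepFun hind'
    (s := Finset.univ) (fun i _ => (hsub i).neg) hε).trans hexp
  have hsubset : {x : Sigma2 |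
      t * n ≤ |(N0count x (2 * n) : ℝ) - ∫ y, (N0count y (2 * n) : ℝ) ∂P|} ⊆
      {x | t * n ≤ ∑ i, Y i x} ∪ {x | t * n ≤ ∑ i, (-Y i) x} := by
    intro x hx
    rw [Set.mem_ofPred_eq, ← sum_centredZeros, le_abs, ← Finset.sum_neg_distrib] at hx
    exact hx
  rw [ENNReal.le_ofReal_iff_toReal_le (measure_ne_top _ _) (by positivity)]
  calc P.real _ ≤ P.real _ := measureReal_mono hsubset
    _ ≤ _ := measureReal_union_le _ _
    _ ≤ _ := by linarith

end
end
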